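/- arXiv:2502.21184 — 2 statements merged into one kernel-verified Lean document; each statement's English description precedes it below -/
import Mathlib

section
/- Let λ be a strictly decreasing partition of length m and let (S, v) be an arborescent poset with surjective consistent anti-linearization v : S → [1,m]. Then the poset D_S of S-dominant compositions (ordered by Bruhat order) is graded: its Hasse diagram is a subgraph of the Bruhat graph of S_m, and the rank of an S-dominant composition d equals #{(s,t) ∈ S × S : s is not ⪰ t, v(s) < v(t), and d_{v(s)} < d_{v(t)}}. -/
/-- An arborescent poset with consistent anti-linearization: a poset `S` with an
order-reversing injection `v : S → Fin m` such that whenever `v s < v t < v r` and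
`r < s`, also `r < t`. -/
structure AntiLin (S : Type*) [PartialOrder S] (m : ℕ) where
  v : S → Fin m
  inj : Function.Injective v
  anti : ∀ ⦃s t : S⦄, t < s → v s < v t
  cons : ∀ ⦃s t r : S⦄, v s < v t → v t < v r → r < s → r < t

/-- A composition `d` is `S`-dominant: it vanishes outside the image of `v`, and
`d (v t) ≤ d (v s)` whenever `t < s` in `S`. -/
def SDominant {S : Type*} [PartialOrder S] {m : ℕ} (A : AntiLin S m)
    (d : Fin m → ℕ) : Prop :=
  (∀ l : Fin m, (∀ s : S, A.v s ≠ l) → d l = 0) ∧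
  (∀ s t : S, t < s → d (A.v t) ≤ d (A.v s))

/-- `(i, j)` is a minimal `S`-disorder for the composition `d`: `i < j`, the preimages
of `i` and `j` under `v` are incomparable, `d i > d j`, and for every `l` with
`i < l < j` lying in the image of `v`: if `v⁻¹ l ≺ v⁻¹ i` then `d l ≤ d j`; if
`v⁻¹ l ≻ v⁻¹ j` then `d l ≥ d i`; and if `v⁻¹ l` is incomparable with both then
`d l ∉ [d j, d i]`. -/
def MinDisorder {S : Type*} [PartialOrder S] {m : ℕ} (A : AntiLin S m)
    (d : Fin m → ℕ) (i j : Fin m) : Prop :=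
  i < j ∧ d j < d i ∧
  ∃ si sj : S, A.v si = i ∧ A.v sj = j ∧ ¬ si ≤ sj ∧ ¬ sj ≤ si ∧
    ∀ (l : Fin m) (sl : S), A.v sl = l → i < l → l < j →
      (sl < si → d l ≤ d j) ∧ (sj < sl → d i ≤ d l) ∧
      ((¬ sl ≤ si ∧ ¬ si ≤ sl ∧ ¬ sl ≤ sj ∧ ¬ sj ≤ sl) →
        ¬(d j ≤ d l ∧ d l ≤ d i))

/-- One step up in the Bruhat order on compositions: swap two entries in disorder. -/
def BruhatStep {m : ℕ} (d d' : Fin m → ℕ) : Prop :=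
  ∃ i j : Fin m, i < j ∧ d j < d i ∧ d' = d ∘ Equiv.swap i j

/-- The Bruhat partial order on (an `S_m`-orbit of) compositions: the reflexive
transitive closure of disorder swaps. -/
def BruhatLE {m : ℕ} : (Fin m → ℕ) → (Fin m → ℕ) → Prop :=
  Relation.ReflTransGen BruhatStep

/-- Strict Bruhat order. -/
def BruhatLT {m : ℕ} (d d' : Fin m → ℕ) : Prop :=
  BruhatLE d d' ∧ d ≠ d'

/-- The rank of an `S`-dominant composition: the number of pairs `(s, t)` with
`s` not `⪰ t`, `v s < v t` and `d (v s) < d (v t)`. -/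
noncomputable def domRank {S : Type*} [PartialOrder S] {m : ℕ} (A : AntiLin S m)
    (d : Fin m → ℕ) : ℕ :=
  Set.ncard {p : S × S | ¬ p.2 ≤ p.1 ∧ A.v p.1 < A.v p.2 ∧ d (A.v p.1) < d (A.v p.2)}


namespace Brk

/-- normalized permutations, as functions to `ℕ` -/
def IsP {m : ℕ} (w : Fin m → ℕ) : Prop := Function.Injective w ∧ ∀ i, w i < m

/-- rank matrix -/
def r {m : ℕ} (w : Fin m → ℕ) (p q : ℕ) : ℕ :=
  ((Finset.univ : Finset (Fin m)).filter (fun l => l.val < p ∧ q ≤ w l)).card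

def rle {m : ℕ} (u w : Fin m → ℕ) : Prop := ∀ p q, r w p q ≤ r u p q

/-- swap the values `k` and `k+1` -/
def sv (k x : ℕ) : ℕ := if x = k then k + 1 else if x = k + 1 then k else x

noncomputable def len {m : ℕ} (w : Fin m → ℕ) : ℕ :=
  Set.ncard {p : Fin m × Fin m | p.1 < p.2 ∧ w p.1 < w p.2}

def Dom {m : ℕ} (X : Fin m → Fin m → Prop) (w : Fin m → ℕ) : Prop :=
  ∀ i j, X i j → w j < w i

variable {m : ℕ}

lemma sv_sv (k x : ℕ) : sv k (sv k x) = x := by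
  unfold sv; grind

lemma sv_inj (k : ℕ) : Function.Injective (sv k) := fun x y h => by
  rw [← sv_sv k x, h, sv_sv]

lemma sv_left (k : ℕ) : sv k k = k + 1 := by simp [sv]
lemma sv_right (k : ℕ) : sv k (k+1) = k := by simp [sv]

lemma sv_le (k x q : ℕ) (hq : q ≠ k + 1) : q ≤ sv k x ↔ q ≤ x := by
  unfold sv; grind

lemma IsP.surj {w : Fin m → ℕ} (hw : IsP w) (q : ℕ) (hq : q < m) : ∃ i, w i = q := by
  have h1 : Function.Injective (fun i => (⟨w i, hw.2 i⟩ : Fin m)) := by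
    intro i j h
    exact hw.1 (by simpa using h)
  obtain ⟨i, hi⟩ := (Finite.injective_iff_surjective.1 h1) ⟨q, hq⟩
  exact ⟨i, by simpa using congrArg Fin.val hi⟩

lemma IsP.sv {w : Fin m → ℕ} (hw : IsP w) (k : ℕ) (hk : k + 1 < m) : IsP (fun i => sv k (w i)) := by
  refine ⟨fun i j h => hw.1 (sv_inj k h), fun i => ?_⟩
  have := hw.2 i
  unfold Brk.sv
  grind

lemma r_succ (w : Fin m → ℕ) (l : Fin m) (q : ℕ) :
    r w (l.val + 1) q = r w l.val q + if q ≤ w l then 1 else 0 := by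
  unfold r
  split_ifs with h
  · rw [← Finset.card_insert_of_notMem (a := l) (by simp)]
    congr 1
    ext x
    simp only [Finset.mem_filter, Finset.mem_univ, true_and, Finset.mem_insert]
    constructor
    · rintro ⟨h1, h2⟩
      by_cases hx : x = l
      · exact Or.inl hx
      · right
        have : x.val ≠ l.val := fun h => hx (Fin.ext h)
        exact ⟨by omega, h2⟩
    · rintro (rfl | ⟨h1, h2⟩)
      · exact ⟨by omega, h⟩
      · exact ⟨by omega, h2⟩
  · refine (congrArg Finset.card ?_).trans (Nat.add_zero _).symm
    ext x
    simp only [Finset.mem_filter, Finset.mem_univ, true_and]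
    constructor
    · rintro ⟨h1, h2⟩
      by_cases hx : x = l
      · subst hx; exact absurd h2 h
      · have : x.val ≠ l.val := fun h => hx (Fin.ext h)
        exact ⟨by omega, h2⟩
    · rintro ⟨h1, h2⟩
      exact ⟨by omega, h2⟩

lemma r_val (w : Fin m → ℕ) (hw : Function.Injective w) (P : Fin m) (p : ℕ) :
    r w p (w P) = r w p (w P + 1) + if P.val < p then 1 else 0 := by
  unfold r
  split_ifs with h
  · rw [← Finset.card_insert_of_notMem (a := P) (by simp)]
    refine congrArg Finset.card ?_
    ext x
    simp only [Finset.mem_filter, Finset.mem_univ, true_and, Finset.mem_insert]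
    constructor
    · rintro ⟨h1, h2⟩
      by_cases hx : x = P
      · exact Or.inl hx
      · right
        have : w x ≠ w P := fun h => hx (hw h)
        exact ⟨h1, by omega⟩
    · rintro (rfl | ⟨h1, h2⟩)
      · exact ⟨h, le_rfl⟩
      · exact ⟨h1, by omega⟩
  · refine (congrArg Finset.card ?_).trans (Nat.add_zero _).symm
    ext x
    simp only [Finset.mem_filter, Finset.mem_univ, true_and]
    constructor
    · rintro ⟨h1, h2⟩
      have hx : x ≠ P := by rintro rfl; exact h h1
      have : w x ≠ w P := fun h => hx (hw h)
      exact ⟨h1, by omega⟩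
    · rintro ⟨h1, h2⟩
      exact ⟨h1, by omega⟩

lemma r_val' {w : Fin m → ℕ} (hw : IsP w) {P : Fin m} {k : ℕ} (h : w P = k) (p : ℕ) :
    r w p k = r w p (k + 1) + if P.val < p then 1 else 0 := by
  subst h; exact r_val w hw.1 P p

lemma r_sv (w : Fin m → ℕ) (k p q : ℕ) (hq : q ≠ k + 1) :
    r (fun i => sv k (w i)) p q = r w p q := by
  unfold r
  simp only [sv_le k _ q hq]

lemma r_sv_mid {w : Fin m → ℕ} (hw : IsP w) {P : Fin m} {k : ℕ} (h : w P = k) (hk : k + 1 < m)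
    (p : ℕ) : r (fun i => sv k (w i)) p (k + 1) = r w p (k + 1 + 1) + if P.val < p then 1 else 0 := by
  rw [r_val' (hw.sv k hk) (P := P) (by simp [h, sv_left]), r_sv _ _ _ _ (by omega)]

lemma step_rle {d d' : Fin m → ℕ} (h : BruhatStep d d') : rle d d' := by
  obtain ⟨i, j, hij, hd, rfl⟩ := h
  intro p q
  unfold r
  by_cases hj : j.val < p
  · refine Finset.card_le_card_of_injOn (Equiv.swap i j) ?_ (Equiv.injective _).injOn
    intro l hl
    simp only [Finset.coe_filter, Finset.mem_univ, true_and, Set.mem_ofPred_eq,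
      Function.comp] at hl ⊢
    refine ⟨?_, hl.2⟩
    rw [Equiv.swap_apply_def]
    have : i.val < j.val := hij
    split_ifs <;> omega
  · refine Finset.card_le_card ?_
    intro l hl
    simp only [Finset.mem_filter, Finset.mem_univ, true_and, Function.comp] at hl ⊢
    refine ⟨hl.1, ?_⟩
    have h2 := hl.2
    rw [Equiv.swap_apply_def] at h2
    split_ifs at h2 with h3 h4
    · subst h3; omega
    · subst h4; omega
    · exact h2

lemma rle_trans {a b c : Fin m → ℕ} (h : rle a b) (h' : rle b c) : rle a c :=
  fun p q => (h' p q).trans (h p q)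

lemma le_rle {d d' : Fin m → ℕ} (h : BruhatLE d d') : rle d d' := by
  induction h with
  | refl => exact fun p q => le_rfl
  | tail _ h ih => exact rle_trans ih (step_rle h)

lemma len_sv {w : Fin m → ℕ} (hw : IsP w) {P Q : Fin m} (hPQ : P < Q) {k : ℕ} (hP : w P = k)
    (hQ : w Q = k + 1) : len w = len (fun i => sv k (w i)) + 1 := by
  unfold len
  rw [← Set.ncard_insert_of_notMem (a := (P, Q)) _ (Set.toFinite _)]
  · congr 1
    ext ⟨i, j⟩
    simp only [Set.mem_ofPred_eq, Set.mem_insert_iff, Prod.mk.injEq]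
    have h1 : w i = k ↔ i = P := ⟨fun h => hw.1 (h.trans hP.symm), fun h => h ▸ hP⟩
    have h2 : w j = k ↔ j = P := ⟨fun h => hw.1 (h.trans hP.symm), fun h => h ▸ hP⟩
    have h3 : w i = k+1 ↔ i = Q := ⟨fun h => hw.1 (h.trans hQ.symm), fun h => h ▸ hQ⟩
    have h4 : w j = k+1 ↔ j = Q := ⟨fun h => hw.1 (h.trans hQ.symm), fun h => h ▸ hQ⟩
    unfold sv
    by_cases a1 : i = P <;> by_cases a2 : j = P <;> by_cases a3 : i = Q <;> by_cases a4 : j = Q <;>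
      grind
  · simp [hP, hQ, sv_left, sv_right]

/-- a permutation without adjacent-value ascents is minimal -/
lemma eq_of_no_asc {u w : Fin m → ℕ} (hu : IsP u) (hw : IsP w) (h : rle u w)
    (hno : ∀ P Q : Fin m, w Q = w P + 1 → Q < P) : u = w := by
  have anti : ∀ n : ℕ, ∀ P Q : Fin m, w Q = w P + 1 + n → Q < P := by
    intro n
    induction n with
    | zero => exact hno
    | succ n ih =>
      intro P Q hh
      obtain ⟨R, hR⟩ := hw.surj (w P + 1 + n) (by have := hw.2 Q; omega)
      exact (hno R Q (by omega)).trans (ih P R hR)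
  have key : ∀ n : ℕ, ∀ i : Fin m, i.val = n → u i = w i := by
    intro n
    induction n using Nat.strong_induction_on with
    | _ n ih =>
      intro i hi
      have h1 := h (i.val + 1) (w i)
      rw [r_succ, r_succ] at h1
      have h2 : r w i.val (w i) = r u i.val (w i) := by
        unfold r
        congr 1
        ext l
        simp only [Finset.mem_filter, Finset.mem_univ, true_and]
        refine and_congr_right fun hl => ?_
        rw [ih l.val (by omega) l rfl]
      have h3 : w i ≤ u i := by
        by_contra hc
        simp [hc, h2] at h1
      obtain ⟨l, hl⟩ := hw.surj (u i) (hu.2 i)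
      have h4 : ¬ l.val < i.val := by
        intro hli
        have := ih l.val (by omega) l rfl
        have h5 : l = i := hu.1 (this.trans hl)
        subst h5; omega
      by_contra hne
      have h6 := anti (u i - w i - 1) i l (by omega)
      exact h4 h6
  exact funext fun i => key _ i rfl

lemma dom_down {X : Fin m → Fin m → Prop} (hX1 : ∀ i j, X i j → i < j) {w : Fin m → ℕ}
    (hw : IsP w) (hd : Dom X w) {P Q : Fin m} (hPQ : P < Q) {k : ℕ} (hP : w P = k)
    (hQ : w Q = k + 1) : Dom X (fun i => sv k (w i)) := by
  intro i j hij
  have h1 := hd i j hij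
  have h2 := hX1 i j hij
  by_cases h : w j = k ∧ w i = k + 1
  · have e1 : j = P := hw.1 (h.1.trans hP.symm)
    have e2 : i = Q := hw.1 (h.2.trans hQ.symm)
    subst e1 e2
    exact absurd h2 hPQ.asymm
  · simp only [sv]; grind

lemma claim {X : Fin m → Fin m → Prop}
    (hX1 : ∀ i j, X i j → i < j) (hX2 : ∀ i l j, X i j → i < l → l < j → X l j)
    {u x : Fin m → ℕ} (hx : IsP x) (hdu : Dom X u) (hdx : Dom X x) {i j : Fin m}
    (hij : X i j) {k : ℕ} (hi : x i = k + 1) (hj : x j = k) (hk : k + 1 < m)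
    (h : rle u (fun l => sv k (x l))) : rle u x := by
  have hlt : i.val < j.val := hX1 i j hij
  intro p q
  by_cases hq : q = k + 1
  swap
  · rw [← r_sv x k p q hq]; exact h p q
  subst hq
  set z : Fin m → ℕ := fun l => sv k (x l) with hz
  have e1 := r_val' hx hi p
  have e2 := r_sv_mid hx hj hk p
  have h0 := h p (k+1)
  rw [← hz] at e2
  by_contra hcon
  have hp : i.val < p ∧ p ≤ j.val := by
    by_cases a1 : i.val < p <;> by_cases a2 : j.val < p <;> simp only [a1, a2, if_true, if_false] at e1 e2 <;> omega
  have hD : r u p (k+1) ≤ r z p (k+1) := by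
    have a2 : ¬ j.val < p := by omega
    simp only [hp.1, a2, if_true, if_false] at e1 e2
    omega
  have zi : z i = k := by simp [hz, hi, sv_right]
  have zj : z j = k + 1 := by simp [hz, hj, sv_left]
  have zl : ∀ l : Fin m, i < l → l < j → k + 1 ≤ z l := by
    intro l h1 h2
    have h3 := hdx l j (hX2 i l j hij h1 h2)
    have h4 : x l ≠ k + 1 := fun hh => h1.ne (hx.1 (hi.trans hh.symm))
    simp only [hz, sv]
    grind
  have A : ∀ t, p ≤ t → t ≤ j.val → r u t (k+1) ≤ r z t (k+1) := by
    intro t ht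
    induction t, ht using Nat.le_induction with
    | base => exact fun _ => hD
    | succ t ht ih =>
      intro htj
      have := ih (by omega)
      have hl := zl ⟨t, by omega⟩ (by rw [Fin.lt_def]; simp; omega) (by rw [Fin.lt_def]; simp; omega)
      have a1 := r_succ z ⟨t, by omega⟩ (k+1)
      have a2 := r_succ u ⟨t, by omega⟩ (k+1)
      rw [if_pos hl] at a1
      simp only at a1 a2
      split_ifs at a2 <;> omega
  have uj : k + 1 ≤ u j := by
    have a0 := A j.val hp.2 le_rfl
    have a1 := r_succ z j (k+1)
    have a2 := r_succ u j (k+1)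
    have a3 := h (j.val+1) (k+1)
    by_contra hc
    rw [if_neg hc] at a2
    rw [if_pos zj.ge] at a1
    omega
  have ul : ∀ l : Fin m, i ≤ l → l < j → k + 1 ≤ u l := by
    intro l h1 h2
    have : X l j := by
      rcases h1.eq_or_lt with rfl | h1
      · exact hij
      · exact hX2 i l j hij h1 h2
    have := hdu l j this
    omega
  have B : ∀ t, i.val + 1 ≤ t → t ≤ j.val → r z t (k+1) + 1 ≤ r u t (k+1) := by
    intro t ht
    induction t, ht using Nat.le_induction with
    | base =>
      intro _
      have a1 := r_succ z i (k+1)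
      have a2 := r_succ u i (k+1)
      have a3 := h i.val (k+1)
      rw [if_pos (ul i le_rfl hlt)] at a2
      rw [if_neg (by omega)] at a1
      omega
    | succ t ht ih =>
      intro htj
      have := ih (by omega)
      have hl := ul ⟨t, by omega⟩ (by rw [Fin.le_def]; simp; omega) (by rw [Fin.lt_def]; simp; omega)
      have a1 := r_succ z ⟨t, by omega⟩ (k+1)
      have a2 := r_succ u ⟨t, by omega⟩ (k+1)
      rw [if_pos hl] at a2
      simp only at a1 a2
      split_ifs at a1 <;> omega
  have := B p hp.1 hp.2
  omega

lemma core {X : Fin m → Fin m → Prop}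
    (hX1 : ∀ i j, X i j → i < j) (hX2 : ∀ i l j, X i j → i < l → l < j → X l j) :
    ∀ n : ℕ, ∀ u w : Fin m → ℕ, len w = n → IsP u → IsP w → Dom X u → Dom X w → rle u w → u ≠ w →
      ∃ x, IsP x ∧ Dom X x ∧ BruhatStep x w ∧ len w = len x + 1 ∧ rle u x := by
  intro n
  induction n with
  | zero =>
    intro u w hn hu hw hdu hdw h hne
    exfalso
    apply hne
    apply eq_of_no_asc hu hw h
    intro P Q hPQ
    by_contra hc
    have hne' : P ≠ Q := by rintro rfl; omega
    have := len_sv hw (lt_of_le_of_ne (not_lt.1 hc) hne') rfl hPQ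
    omega
  | succ n ih =>
    intro u w hn hu hw hdu hdw h hne
    obtain ⟨P, Q, hPQ, hlt⟩ : ∃ P Q : Fin m, w Q = w P + 1 ∧ P < Q := by
      by_contra hc
      push Not at hc
      apply hne
      apply eq_of_no_asc hu hw h
      intro P Q hPQ
      have hne' : P ≠ Q := by rintro rfl; omega
      exact lt_of_le_of_ne (hc P Q hPQ) hne'.symm
    obtain ⟨k, hk⟩ : ∃ k, w P = k := ⟨_, rfl⟩
    rw [hk] at hPQ
    have hkm : k + 1 < m := hPQ ▸ hw.2 Q
    have hws := hw.sv k hkm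
    have hdws := dom_down hX1 hw hdw hlt hk hPQ
    have hlen := len_sv hw hlt hk hPQ
    by_cases hus : rle u (fun i => sv k (w i))
    · refine ⟨_, hws, hdws, ⟨P, Q, hlt, ?_, ?_⟩, hlen, hus⟩
      · simp [hk, hPQ, sv_left, sv_right]
      · funext i
        simp only [Function.comp, Equiv.swap_apply_def]
        split_ifs with h1 h2
        · subst h1; simp [hk, hPQ, sv_right]
        · subst h2; simp [hk, hPQ, sv_left]
        · have h3 : w i ≠ k := fun hh => h1 (hw.1 (hh.trans hk.symm))
          have h4 : w i ≠ k + 1 := fun hh => h2 (hw.1 (hh.trans hPQ.symm))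
          simp [sv, h3, h4]
    obtain ⟨P', hP'⟩ := hu.surj k (by omega)
    obtain ⟨Q', hQ'⟩ := hu.surj (k+1) hkm
    have hlt' : P' < Q' := by
      by_contra hc
      have hc' : Q'.val ≤ P'.val := not_lt.1 hc
      apply hus
      intro p q
      by_cases hq : q = k + 1
      swap
      · rw [r_sv _ _ _ _ hq]; exact h p q
      subst hq
      rw [r_sv_mid hw hk hkm]
      have a1 := r_val' hu hP' p
      have a2 := r_val' hu hQ' p
      have b1 := r_val' hw hk p
      have b2 := r_val' hw hPQ p
      have c1 := h p k
      have c2 := h p (k+1+1)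
      have hl : P.val < Q.val := hlt
      split_ifs at * <;> omega
    have hl' : P'.val < Q'.val := hlt'
    have hl : P.val < Q.val := hlt
    have hsu : rle (fun i => sv k (u i)) (fun i => sv k (w i)) := by
      intro p q
      by_cases hq : q = k + 1
      swap
      · rw [r_sv _ _ _ _ hq, r_sv _ _ _ _ hq]; exact h p q
      subst hq
      rw [r_sv_mid hw hk hkm, r_sv_mid hu hP' hkm]
      have a1 := r_val' hu hP' p
      have a2 := r_val' hu hQ' p
      have b1 := r_val' hw hk p
      have b2 := r_val' hw hPQ p
      have c1 := h p k
      have c2 := h p (k+1+1)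
      split_ifs at * <;> omega
    obtain ⟨x, hx, hdx, hstep, hlx, hux⟩ := ih (fun i => sv k (u i)) (fun i => sv k (w i))
      (by omega) (hu.sv k hkm) hws (dom_down hX1 hu hdu hlt' hP' hQ') hdws hsu
      (fun hh => hne (funext fun i => sv_inj k (congrFun hh i)))
    have hnux : ¬ rle u x := fun hh => hus (rle_trans hh (step_rle hstep))
    obtain ⟨Px, hPx⟩ := hx.surj k (by omega)
    obtain ⟨Qx, hQx⟩ := hx.surj (k+1) hkm
    have hne2 : Px ≠ Qx := by rintro rfl; omega
    have hux' : ∀ p q, q ≠ k + 1 → r x p q ≤ r u p q := by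
      intro p q hq
      rw [← r_sv u k p q hq]; exact hux p q
    have hltx : Qx < Px := by
      by_contra hc
      have hc' : Px.val ≤ Qx.val := not_lt.1 hc
      apply hnux
      intro p q
      by_cases hq : q = k + 1
      swap
      · exact hux' p q hq
      subst hq
      have a1 := r_val' hu hP' p
      have a2 := r_val' hu hQ' p
      have b1 := r_val' hx hPx p
      have b2 := r_val' hx hQx p
      have c1 := hux' p k (by omega)
      have c2 := hux' p (k+1+1) (by omega)
      split_ifs at * <;> omega
    have hlx' : Qx.val < Px.val := hltx
    have husx : rle u (fun i => sv k (x i)) := by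
      intro p q
      by_cases hq : q = k + 1
      swap
      · rw [r_sv _ _ _ _ hq]; exact hux' p q hq
      subst hq
      rw [r_sv_mid hx hPx hkm]
      have a1 := r_val' hu hP' p
      have a2 := r_val' hu hQ' p
      have b1 := r_val' hx hPx p
      have b2 := r_val' hx hQx p
      have c1 := hux' p k (by omega)
      have c2 := hux' p (k+1+1) (by omega)
      split_ifs at * <;> omega
    have hlsx := len_sv (hx.sv k hkm) hltx (k := k) (by simp [hQx, sv_right])
      (by simp [hPx, sv_left])
    simp only [sv_sv] at hlsx
    change len (fun i => sv k (x i)) = len x + 1 at hlsx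
    refine ⟨fun i => sv k (x i), hx.sv k hkm, ?_, ?_, by omega, husx⟩
    · intro i j hij
      by_contra hc
      have h1 := hdx i j hij
      have h2 : x i = k + 1 ∧ x j = k := by
        simp only [sv] at hc; grind
      exact hnux (claim hX1 hX2 hx hdu hdx hij h2.1 h2.2 hkm husx)
    · obtain ⟨i, j, hij, hlij, he⟩ := hstep
      have hw' : ∀ l, w l = sv k (x (Equiv.swap i j l)) := by
        intro l
        have := congrFun he l
        simp only [Function.comp] at this
        rw [← this, sv_sv]
      refine ⟨i, j, hij, ?_, funext fun l => hw' l⟩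
      by_contra hc
      have h2 : x i = k + 1 ∧ x j = k := by
        simp only [sv] at hc; grind
      have e1 := hw' i
      have e2 := hw' j
      rw [Equiv.swap_apply_left, h2.2, sv_left] at e1
      rw [Equiv.swap_apply_right, h2.1, sv_right] at e2
      have f1 : i = Q := hw.1 (e1.trans hPQ.symm)
      have f2 : j = P := hw.1 (e2.trans hk.symm)
      subst f1 f2
      exact absurd hij hlt.asymm

lemma rle_le {X : Fin m → Fin m → Prop}
    (hX1 : ∀ i j, X i j → i < j) (hX2 : ∀ i l j, X i j → i < l → l < j → X l j) :
    ∀ n : ℕ, ∀ u w : Fin m → ℕ, len w = n → IsP u → IsP w → Dom X u → Dom X w → rle u w →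
      BruhatLE u w ∧ (u ≠ w → len u < len w) := by
  intro n
  induction n with
  | zero =>
    intro u w hn hu hw hdu hdw h
    by_cases hne : u = w
    · subst hne; exact ⟨Relation.ReflTransGen.refl, fun h => absurd rfl h⟩
    · obtain ⟨x, hx⟩ := core hX1 hX2 _ u w rfl hu hw hdu hdw h hne
      omega
  | succ n ih =>
    intro u w hn hu hw hdu hdw h
    by_cases hne : u = w
    · subst hne; exact ⟨Relation.ReflTransGen.refl, fun h => absurd rfl h⟩
    · obtain ⟨x, hx, hdx, hs, hl, hux⟩ := core hX1 hX2 _ u w rfl hu hw hdu hdw h hne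
      obtain ⟨h1, h2⟩ := ih u x (by omega) hu hx hdu hdx hux
      refine ⟨h1.tail hs, fun _ => ?_⟩
      by_cases hux' : u = x
      · subst hux'; omega
      · have := h2 hux'; omega

lemma transfer (f g : Fin m → ℕ) (hfg : ∀ i j, f i < f j → g i < g j) (σ : Equiv.Perm (Fin m))
    (d : Fin m → ℕ) (h : BruhatLE (f ∘ σ) d) :
    ∃ τ : Equiv.Perm (Fin m), d = f ∘ τ ∧ BruhatLE (g ∘ σ) (g ∘ τ) := by
  induction h with
  | refl => exact ⟨σ, rfl, Relation.ReflTransGen.refl⟩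
  | tail _ hs ih =>
    obtain ⟨τ, rfl, h2⟩ := ih
    obtain ⟨i, j, hij, hlt, rfl⟩ := hs
    refine ⟨(Equiv.swap i j).trans τ, rfl, h2.tail ⟨i, j, hij, hfg _ _ hlt, rfl⟩⟩

/-- standardization -/
def N (a : Fin m → ℕ) (i : Fin m) : ℕ :=
  ((Finset.univ : Finset (Fin m)).filter (fun l => a l < a i)).card

lemma N_lt {a : Fin m → ℕ} {i j : Fin m} (h : a i < a j) : N a i < N a j := by
  apply Finset.card_lt_card
  rw [Finset.ssubset_iff_of_subset]
  · exact ⟨i, by simpa using h, by simp⟩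
  · intro l hl
    simp only [Finset.mem_filter, Finset.mem_univ, true_and] at hl ⊢
    omega

lemma N_isP {a : Fin m → ℕ} (ha : Function.Injective a) : IsP (N a) := by
  constructor
  · intro i j h
    rcases lt_trichotomy (a i) (a j) with h1 | h1 | h1
    · have := N_lt h1; omega
    · exact ha h1
    · have := N_lt h1; omega
  · intro i
    have : N a i < (Finset.univ : Finset (Fin m)).card := by
      apply Finset.card_lt_card
      rw [Finset.ssubset_iff_of_subset (Finset.filter_subset _ _)]
      exact ⟨i, by simp, by simp⟩
    simpa using this

lemma N_lt_iff {a : Fin m → ℕ} (i j : Fin m) : N a i < N a j ↔ a i < a j := by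
  refine ⟨fun h => ?_, N_lt⟩
  by_contra hc
  rcases (not_lt.1 hc).eq_or_lt with h1 | h1
  · simp [N, h1] at h
  · have := N_lt h1; omega

lemma IsP.comp {w : Fin m → ℕ} (hw : IsP w) (σ : Equiv.Perm (Fin m)) : IsP (w ∘ σ) :=
  ⟨hw.1.comp σ.injective, fun i => hw.2 _⟩

lemma domRank_eq {S : Type*} [PartialOrder S] (A : AntiLin S m)
    (hsurj : Function.Surjective A.v) {d : Fin m → ℕ} (hd : SDominant A d) :
    domRank A d = len d := by
  unfold domRank len
  rw [← Set.ncard_image_of_injective _ (Function.Injective.prodMap A.inj A.inj)]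
  congr 1
  ext ⟨i, j⟩
  obtain ⟨s, rfl⟩ := hsurj i
  obtain ⟨t, rfl⟩ := hsurj j
  simp only [Set.mem_image, Set.mem_ofPred_eq, Prod.exists, Prod.map_apply, Prod.mk.injEq]
  constructor
  · rintro ⟨s', t', ⟨h1, h2, h3⟩, e1, e2⟩
    rw [← e1, ← e2]; exact ⟨h2, h3⟩
  · rintro ⟨h2, h3⟩
    refine ⟨s, t, ⟨fun hle => ?_, h2, h3⟩, rfl, rfl⟩
    rcases hle.eq_or_lt with h | h
    · subst h; omega
    · have := hd.2 _ _ h; omega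

end Brk

/-- For a surjective anti-linearization and regular `λ`, the poset of `S`-dominant
compositions is graded: every covering relation among `S`-dominant compositions is a
covering relation of the full Bruhat order on `S_m`, and the rank function
`domRank` increases by exactly one along it. -/
theorem stmt_11 {S : Type*} [PartialOrder S] [Finite S] {m : ℕ} (A : AntiLin S m)
    (hsurj : Function.Surjective A.v)
    (a b : Fin m → ℕ) (hreg : Function.Injective a)
    (ha : SDominant A a) (hb : SDominant A b)
    (hlt : BruhatLT a b)
    (hcov : ¬ ∃ c : Fin m → ℕ, SDominant A c ∧ BruhatLT a c ∧ BruhatLT c b) :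
    (¬ ∃ c : Fin m → ℕ, BruhatLT a c ∧ BruhatLT c b) ∧
    domRank A b = domRank A a + 1 := by
  set X : Fin m → Fin m → Prop := fun i j => ∃ s t, A.v s = i ∧ A.v t = j ∧ t < s with hXdef
  have hX1 : ∀ i j, X i j → i < j := by
    rintro _ _ ⟨s, t, rfl, rfl, h⟩
    exact A.anti h
  have hX2 : ∀ i l j, X i j → i < l → l < j → X l j := by
    rintro _ l _ ⟨s, t, rfl, rfl, h⟩ h1 h2
    obtain ⟨y, rfl⟩ := hsurj l
    exact ⟨y, t, rfl, rfl, A.cons h1 h2 h⟩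
  have hNP := Brk.N_isP hreg
  have dom_iff : ∀ τ : Equiv.Perm (Fin m), SDominant A (a ∘ τ) ↔ Brk.Dom X (Brk.N a ∘ τ) := by
    intro τ
    constructor
    · rintro ⟨-, h⟩ _ _ ⟨s, t, rfl, rfl, hst⟩
      refine Brk.N_lt (lt_of_le_of_ne (h s t hst) fun he => ?_)
      exact hst.ne (A.inj (τ.injective (hreg he)))
    · intro h
      refine ⟨fun l hl => ?_, fun s t hst => ?_⟩
      · obtain ⟨s, hs⟩ := hsurj l
        exact absurd hs (hl s)
      · exact ((Brk.N_lt_iff _ _).1 (h _ _ ⟨s, t, rfl, rfl, hst⟩)).le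
  have len_eq : ∀ τ : Equiv.Perm (Fin m), Brk.len (a ∘ τ) = Brk.len (Brk.N a ∘ τ) := by
    intro τ
    unfold Brk.len
    simp only [Function.comp, Brk.N_lt_iff]
  have hforth : ∀ i j, a i < a j → Brk.N a i < Brk.N a j := fun i j => Brk.N_lt
  have hback : ∀ i j, Brk.N a i < Brk.N a j → a i < a j := fun i j => (Brk.N_lt_iff i j).1
  have hinjN : ∀ σ τ : Equiv.Perm (Fin m), Brk.N a ∘ σ = Brk.N a ∘ τ → σ = τ := by
    intro σ τ h
    ext i
    exact congrArg Fin.val (hNP.1 (congrFun h i))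
  obtain ⟨β, rfl, hβ⟩ := Brk.transfer a (Brk.N a) hforth 1 b hlt.1
  have hne : Brk.N a ∘ (1 : Equiv.Perm (Fin m)) ≠ Brk.N a ∘ β := by
    intro h
    have := hinjN _ _ h
    subst this
    exact hlt.2 rfl
  have hda : Brk.Dom X (Brk.N a ∘ (1 : Equiv.Perm (Fin m))) := (dom_iff 1).1 ha
  have hdb := (dom_iff β).1 hb
  obtain ⟨x, hx, hdx, hs, hl, hux⟩ := Brk.core hX1 hX2 _ _ _ rfl (hNP.comp 1) (hNP.comp β)
    hda hdb (Brk.le_rle hβ) hne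
  have hle := (Brk.rle_le hX1 hX2 _ _ _ rfl (hNP.comp 1) hx hda hdx hux).1
  obtain ⟨ξ, rfl, hξ⟩ := Brk.transfer (Brk.N a) a hback 1 x hle
  have hstep : BruhatStep (a ∘ ξ) (a ∘ β) := by
    obtain ⟨i, j, hij, h1, h2⟩ := hs
    refine ⟨i, j, hij, hback _ _ h1, ?_⟩
    have := hinjN β ((Equiv.swap i j).trans ξ) h2
    subst this
    rfl
  have hξ1 : ξ = 1 := by
    by_contra hc
    refine hcov ⟨a ∘ ξ, (dom_iff ξ).2 hdx, ⟨hξ, fun h => hc ?_⟩,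
      ⟨Relation.ReflTransGen.single hstep, fun h => ?_⟩⟩
    · ext i
      exact congrArg Fin.val (hreg (congrFun h i)).symm
    · have : ξ = β := by
        ext i
        exact congrArg Fin.val (hreg (congrFun h i))
      subst this
      omega
  subst hξ1
  have hl' : Brk.len (a ∘ β) = Brk.len a + 1 := by
    rw [len_eq, hl, ← len_eq]; rfl
  refine ⟨?_, ?_⟩
  · rintro ⟨c, hac, hcb⟩
    obtain ⟨γ, rfl, hγ⟩ := Brk.transfer a (Brk.N a) hforth 1 c hac.1
    obtain ⟨β', hβ', hγβ⟩ := Brk.transfer a (Brk.N a) hforth γ _ hcb.1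
    have hββ : β = β' := by
      ext i
      exact congrArg Fin.val (hreg (congrFun hβ' i))
    subst hββ
    have E1 : ∀ i j : Fin m, False → i < j := fun _ _ h => h.elim
    have E2 : ∀ i l j : Fin m, False → i < l → l < j → False := fun _ _ _ h _ _ => h
    have E3 : ∀ w : Fin m → ℕ, Brk.Dom (fun _ _ => False) w := fun w _ _ h => h.elim
    have k1 := (Brk.rle_le E1 E2 _ _ _ rfl (hNP.comp 1) (hNP.comp γ) (E3 _) (E3 _)
      (Brk.le_rle hγ)).2 (fun h => hac.2 (by have := hinjN _ _ h; subst this; rfl))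
    have k2 := (Brk.rle_le E1 E2 _ _ _ rfl (hNP.comp γ) (hNP.comp β) (E3 _) (E3 _)
      (Brk.le_rle hγβ)).2 (fun h => hcb.2 (by have := hinjN _ _ h; subst this; rfl))
    omega
  · rw [Brk.domRank_eq A hsurj ha, Brk.domRank_eq A hsurj hb, hl']
end

section
/- Let X be a finite bounded graded subthin shellable poset (every rank-2 open interval has at most 2 elements). Then for all x < y in X, the Möbius function satisfies μ(x, y) = (−1)^{rank(y)−rank(x)} if the interval [x, y] is thin (every rank-2 open subinterval of [x,y] has exactly 2 elements), and μ(x, y) = 0 if [x, y] is subthin but not thin. -/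
/-- The list of edge labels of a chain `l` under an edge labelling `E`. -/
def chainLabels {X Λ : Type*} (E : X → X → Λ) (l : List X) : List Λ :=
  (l.zip l.tail).map fun p => E p.1 p.2

open scoped Classical in
noncomputable def bdF {X : Type*} (d : ℕ) (F φ : Finset X) : ZMod 2 :=
  if φ.card + 1 = d ∧ φ ⊆ F then 1 else 0

lemma face_eq_erase {X : Type*} [DecidableEq X] {d : ℕ} {F φ : Finset X} (hF : F.card = d)
    (h1 : φ.card + 1 = d) (h2 : φ ⊆ F) : ∃ v ∈ F, φ = F.erase v := by
  have hc : (F \ φ).card = 1 := by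
    rw [Finset.card_sdiff_of_subset h2]; omega
  obtain ⟨v, hv⟩ := Finset.card_eq_one.1 hc
  have hvF : v ∈ F \ φ := by rw [hv]; simp
  refine ⟨v, (Finset.mem_sdiff.1 hvF).1, ?_⟩
  ext w
  have : w ∈ F \ φ ↔ w = v := by rw [hv]; simp
  rw [Finset.mem_sdiff] at this
  rw [Finset.mem_erase]
  have := @h2 w
  tauto

open scoped Classical in
lemma bd_bd {X : Type*} [Fintype X] {d : ℕ} {F g : Finset X} (hF : F.card = d)
    (hg : g.card + 2 = d) :
    ∑ φ ∈ (Finset.univ : Finset (Finset X)).filter (fun φ => g ⊆ φ), bdF d F φ = 0 := by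
  unfold bdF
  rw [← Finset.sum_filter, Finset.filter_filter]
  by_cases hgF : g ⊆ F
  · have : (Finset.univ : Finset (Finset X)).filter
        (fun φ => g ⊆ φ ∧ φ.card + 1 = d ∧ φ ⊆ F) = (F \ g).image (fun v => F.erase v) := by
      ext φ
      simp only [Finset.mem_filter, Finset.mem_univ, true_and, Finset.mem_image, Finset.mem_sdiff]
      constructor
      · rintro ⟨h1, h2, h3⟩
        obtain ⟨v, hv, rfl⟩ := face_eq_erase hF h2 h3
        exact ⟨v, ⟨hv, fun h => by simpa using h1 h⟩, rfl⟩
      · rintro ⟨v, ⟨hv, hvg⟩, rfl⟩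
        refine ⟨Finset.subset_erase.2 ⟨hgF, hvg⟩, ?_, Finset.erase_subset _ _⟩
        rw [Finset.card_erase_add_one hv, hF]
    rw [this, Finset.sum_const, Finset.card_image_of_injOn, Finset.card_sdiff_of_subset hgF]
    · have : F.card - g.card = 2 := by omega
      rw [this]; decide
    · intro u hu v hv huv
      have hu' : u ∈ F := (Finset.mem_sdiff.1 (Finset.mem_coe.1 hu)).1
      by_contra hne
      have : u ∈ F.erase v := Finset.mem_erase.2 ⟨hne, hu'⟩
      have h3 : F.erase u = F.erase v := huv
      rw [← h3] at this
      simp at this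
  · rw [Finset.filter_false_of_mem]
    · simp
    · rintro φ - ⟨h1, -, h2⟩
      exact hgF (h1.trans h2)

open scoped Classical in
/-- Exactness of the mod-two chain complex of a shellable complex in codimension one. -/
lemma shell_exact {X ι K : Type*} [Fintype X] [LinearOrder K] (C : Finset ι)
    (f : ι → Finset X) (key : ι → K) (d : ℕ) (hd : ∀ i ∈ C, (f i).card = d)
    (hsh : ∀ F ∈ C, ∀ H ∈ C, H ≠ F → key H ≤ key F →
      ∃ J ∈ C, key J < key F ∧ ∃ v ∈ f F, v ∉ f H ∧ (f F).erase v ⊆ f J) :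
    ∀ (n : ℕ) (S : Finset ι), S ⊆ C → S.card = n →
      (∀ F ∈ S, ∀ H ∈ C, key H < key F → H ∈ S) →
      ∀ e : Finset X → ZMod 2,
        (∀ φ, e φ ≠ 0 → φ.card + 1 = d ∧ ∃ F ∈ S, φ ⊆ f F) →
        (∀ g : Finset X, g.card + 2 = d →
          ∑ φ ∈ (Finset.univ : Finset (Finset X)).filter (fun φ => g ⊆ φ), e φ = 0) →
        ∃ a : ι → ZMod 2, (∀ i, i ∉ S → a i = 0) ∧
          ∀ φ : Finset X, φ.card + 1 = d → ∑ i ∈ C.filter (fun i => φ ⊆ f i), a i = e φ := by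
  intro n
  induction n with
  | zero =>
    intro S _ hS _ e he _
    refine ⟨fun _ => 0, fun _ _ => rfl, fun φ _ => ?_⟩
    by_contra h
    obtain ⟨_, F, hF, _⟩ := he φ (fun h' => h (by simp [h']))
    rw [Finset.card_eq_zero.1 hS] at hF
    simp at hF
  | succ n ih =>
    intro S hSC hS hlow e he hcyc
    have hne : S.Nonempty := by rw [← Finset.card_pos]; omega
    obtain ⟨F, hFS, hmax⟩ := Finset.exists_max_image S key hne
    have hFC := hSC hFS
    have hlow' : ∀ G ∈ S.erase F, ∀ H ∈ C, key H < key G → H ∈ S.erase F := by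
      intro G hG H hH hlt
      have hGS := Finset.mem_of_mem_erase hG
      refine Finset.mem_erase.2 ⟨?_, hlow G hGS H hH hlt⟩
      rintro rfl
      exact absurd (hmax G hGS) (not_le.2 hlt)
    have hcard' : (S.erase F).card = n := by
      rw [Finset.card_erase_of_mem hFS]; omega
    have hsub' : S.erase F ⊆ C := (Finset.erase_subset _ _).trans hSC
    have hshF : ∀ H ∈ S.erase F, ∃ J ∈ S.erase F, ∃ v ∈ f F, v ∉ f H ∧ (f F).erase v ⊆ f J := by
      intro H hH
      have hHS := Finset.mem_of_mem_erase hH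
      obtain ⟨J, hJ, hlt, v, hv⟩ := hsh F hFC H (hSC hHS) (Finset.ne_of_mem_erase hH) (hmax H hHS)
      refine ⟨J, Finset.mem_erase.2 ⟨?_, hlow F hFS J hJ hlt⟩, v, hv⟩
      rintro rfl
      exact lt_irrefl _ hlt
    by_cases hnew : ∃ v ∈ f F, ∀ H ∈ S.erase F, ¬ (f F).erase v ⊆ f H
    · obtain ⟨v, hvF, hv⟩ := hnew
      set c := e ((f F).erase v) with hc
      set e' : Finset X → ZMod 2 := fun φ => e φ + c * bdF d (f F) φ with he'
      have hcardv : ((f F).erase v).card + 1 = d := by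
        rw [Finset.card_erase_add_one hvF, hd F hFC]
      have hev : e' ((f F).erase v) = 0 := by
        simp only [he', bdF]
        rw [if_pos ⟨hcardv, Finset.erase_subset _ _⟩, ← hc, mul_one]
        exact CharTwo.add_self_eq_zero c
      have hsupp0 : ∀ φ, e' φ ≠ 0 → φ.card + 1 = d ∧ ∃ G ∈ S, φ ⊆ f G := by
        intro φ hφ
        by_cases h0 : e φ = 0
        · simp only [he', h0, bdF, zero_add] at hφ
          split_ifs at hφ with h
          · exact ⟨h.1, F, hFS, h.2⟩
          · simp at hφ
        · exact he φ h0
      have hcyc' : ∀ g : Finset X, g.card + 2 = d →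
          ∑ φ ∈ (Finset.univ : Finset (Finset X)).filter (fun φ => g ⊆ φ), e' φ = 0 := by
        intro g hg
        simp only [he', Finset.sum_add_distrib, ← Finset.mul_sum]
        rw [hcyc g hg, bd_bd (hd F hFC) hg]; simp
      have hsupp : ∀ φ, e' φ ≠ 0 → φ.card + 1 = d ∧ ∃ G ∈ S.erase F, φ ⊆ f G := by
        intro φ hφ
        obtain ⟨h1, G, hG, hGφ⟩ := hsupp0 φ hφ
        refine ⟨h1, ?_⟩
        by_contra hno
        push Not at hno
        have hGF : G = F := by
          by_contra hne
          exact hno G (Finset.mem_erase.2 ⟨hne, hG⟩) hGφ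
        subst hGF
        obtain ⟨w, hw, rfl⟩ := face_eq_erase (hd G hFC) h1 hGφ
        have hwv : w ≠ v := by rintro rfl; exact hφ hev
        set g := ((f G).erase v).erase w with hg
        have hwm : w ∈ (f G).erase v := Finset.mem_erase.2 ⟨hwv, hw⟩
        have hgc : g.card + 2 = d := by
          have := Finset.card_erase_add_one hwm
          rw [hg]; omega
        have hgno : ∀ H ∈ S.erase G, ¬ g ⊆ f H := by
          intro H hH hgH
          obtain ⟨J, hJ, u, hu, huH, huJ⟩ := hshF H hH
          by_cases huv : u = v
          · subst huv; exact hv J hJ huJ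
          · by_cases huw : u = w
            · subst huw; exact hno J hJ huJ
            · exact huH (hgH (by simp [hg, huv, huw, hu]))
        have hs := hcyc' g hgc
        rw [Finset.sum_eq_single ((f G).erase w)] at hs
        · exact hφ hs
        · intro ψ hψ hψw
          by_contra hψ0
          obtain ⟨k1, G', hG', k2⟩ := hsupp0 ψ hψ0
          have hgψ := (Finset.mem_filter.1 hψ).2
          have : G' = G := by
            by_contra hne
            exact hgno G' (Finset.mem_erase.2 ⟨hne, hG'⟩) (hgψ.trans k2)
          subst this
          obtain ⟨u, hu, rfl⟩ := face_eq_erase (hd G' hFC) k1 k2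
          by_cases huv : u = v
          · subst huv; exact hψ0 hev
          · by_cases huw : u = w
            · subst huw; exact hψw rfl
            · have : u ∈ (f G').erase u := hgψ (by simp [hg, huv, huw, hu])
              simp at this
        · intro hno'
          exfalso
          apply hno'
          simp only [Finset.mem_filter, Finset.mem_univ, true_and, hg]
          intro z
          simp only [Finset.mem_erase]
          tauto
      obtain ⟨a, ha1, ha2⟩ := ih (S.erase F) hsub' hcard' hlow' e' hsupp hcyc'
      refine ⟨fun i => a i + if i = F then c else 0, ?_, ?_⟩
      · intro i hi
        have h1 : i ≠ F := by rintro rfl; exact hi hFS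
        have h2 : a i = 0 := ha1 i (fun h => hi (Finset.mem_of_mem_erase h))
        simp [h1, h2]
      · intro φ hφ
        rw [Finset.sum_add_distrib, ha2 φ hφ, Finset.sum_ite_eq']
        simp only [he', bdF, Finset.mem_filter, hFC, hφ, true_and]
        have : ∀ p q : ZMod 2, p + q + q = p := by decide
        split_ifs <;> simp [this]
    · push Not at hnew
      obtain ⟨a, ha1, ha2⟩ := ih (S.erase F) hsub' hcard' hlow' e (by
        intro φ hφ
        obtain ⟨h1, G, hG, hGφ⟩ := he φ hφ
        refine ⟨h1, ?_⟩
        by_cases hGF : G = F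
        · subst hGF
          obtain ⟨w, hw, rfl⟩ := face_eq_erase (hd G hFC) h1 hGφ
          exact hnew w hw
        · exact ⟨G, Finset.mem_erase.2 ⟨hGF, hG⟩, hGφ⟩) hcyc
      exact ⟨a, fun i hi => ha1 i (fun h => hi (Finset.mem_of_mem_erase h)), ha2⟩

open scoped Classical in
/-- In a shellable pseudomanifold, a facet all of whose codimension one faces are covered by
earlier facets is the last one, and there is no boundary. -/
lemma shell_pseudo {X ι K : Type*} [Fintype X] [LinearOrder K] (C : Finset ι)
    (f : ι → Finset X) (key : ι → K) (d : ℕ) (hd : ∀ i ∈ C, (f i).card = d)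
    (hsh : ∀ F ∈ C, ∀ H ∈ C, H ≠ F → key H ≤ key F →
      ∃ J ∈ C, key J < key F ∧ ∃ v ∈ f F, v ∉ f H ∧ (f F).erase v ⊆ f J)
    (F0 : ι) (hF0 : F0 ∈ C) (hmin : ∀ F ∈ C, F ≠ F0 → key F0 < key F)
    (hthin : ∀ F ∈ C, ∀ v ∈ f F, (C.filter (fun i => (f F).erase v ⊆ f i)).card ≤ 2)
    (F : ι) (hF : F ∈ C)
    (hfall : ∀ v ∈ f F, ∃ J ∈ C, key J < key F ∧ (f F).erase v ⊆ f J) :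
    (∀ G ∈ C, G ≠ F → key G < key F) ∧
    (∀ G ∈ C, ∀ v ∈ f G, ∃ G' ∈ C, G' ≠ G ∧ (f G).erase v ⊆ f G') := by
  set S := C.filter (fun i => key i < key F) with hSdef
  obtain ⟨a, ha1, ha2⟩ := shell_exact C f key d hd hsh S.card S (Finset.filter_subset _ _) rfl
    (by
      intro G hG H hH hlt
      exact Finset.mem_filter.2 ⟨hH, hlt.trans (Finset.mem_filter.1 hG).2⟩)
    (bdF d (f F))
    (by
      intro φ hφ
      unfold bdF at hφ
      split_ifs at hφ with h
      · refine ⟨h.1, ?_⟩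
        obtain ⟨v, hv, rfl⟩ := face_eq_erase (hd F hF) h.1 h.2
        obtain ⟨J, hJ, hlt, hs⟩ := hfall v hv
        exact ⟨J, Finset.mem_filter.2 ⟨hJ, hlt⟩, hs⟩
      · exact absurd rfl hφ)
    (fun g hg => bd_bd (hd F hF) hg)
  set z : ι → ZMod 2 := fun i => a i + if i = F then 1 else 0 with hz
  have hzF : z F = 1 := by
    have : a F = 0 := ha1 F (by simp [hSdef])
    simp [hz, this]
  have hz0 : ∀ φ : Finset X, φ.card + 1 = d → ∑ i ∈ C.filter (fun i => φ ⊆ f i), z i = 0 := by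
    intro φ hφ
    simp only [hz]
    rw [Finset.sum_add_distrib, ha2 φ hφ, Finset.sum_ite_eq']
    simp only [bdF, Finset.mem_filter, hF, hφ, true_and]
    exact CharTwo.add_self_eq_zero _
  have hadj : ∀ G ∈ C, ∀ J ∈ C, ∀ v ∈ f G, J ≠ G → (f G).erase v ⊆ f J → z G = z J := by
    intro G hG J hJ v hv hne hs
    have hset : C.filter (fun i => (f G).erase v ⊆ f i) = {G, J} := by
      symm
      apply Finset.eq_of_subset_of_card_le
      · intro i hi
        rcases Finset.mem_insert.1 hi with rfl | hi
        · exact Finset.mem_filter.2 ⟨hG, Finset.erase_subset _ _⟩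
        · rw [Finset.mem_singleton.1 hi]
          exact Finset.mem_filter.2 ⟨hJ, hs⟩
      · rw [Finset.card_pair hne.symm]; exact hthin G hG v hv
    have h := hz0 ((f G).erase v) (by rw [Finset.card_erase_add_one hv, hd G hG])
    rw [hset, Finset.sum_pair hne.symm] at h
    exact CharTwo.add_eq_zero.1 h
  have hconst : ∀ (n : ℕ) (G : ι), G ∈ C → (C.filter (fun i => key i < key G)).card = n →
      z G = z F0 := by
    intro n
    induction n using Nat.strong_induction_on with
    | _ n ih =>
      intro G hG hn
      by_cases hGF : G = F0
      · rw [hGF]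
      · obtain ⟨J, hJ, hlt, v, hv, -, hs⟩ := hsh G hG F0 hF0 (Ne.symm hGF) (hmin G hG hGF).le
        rw [hadj G hG J hJ v hv (by rintro rfl; exact lt_irrefl _ hlt) hs]
        refine ih _ ?_ J hJ rfl
        rw [← hn]
        apply Finset.card_lt_card
        refine ⟨fun i hi => ?_, fun h => ?_⟩
        · have := Finset.mem_filter.1 hi
          exact Finset.mem_filter.2 ⟨this.1, this.2.trans hlt⟩
        · have := h (Finset.mem_filter.2 ⟨hJ, hlt⟩)
          simp at this
  have hone : ∀ G ∈ C, z G = 1 := by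
    intro G hG
    rw [hconst _ G hG rfl, ← hconst _ F hF rfl, hzF]
  constructor
  · intro G hG hne
    by_contra hlt
    have h1 := hone G hG
    have h2 : a G = 0 := ha1 G (by simp [hSdef, hlt])
    simp [hz, h2, hne] at h1
  · intro G hG v hv
    by_contra hno
    push Not at hno
    have h := hz0 ((f G).erase v) (by rw [Finset.card_erase_add_one hv, hd G hG])
    have hset : C.filter (fun i => (f G).erase v ⊆ f i) = {G} := by
      ext i
      rw [Finset.mem_filter, Finset.mem_singleton]
      constructor
      · rintro ⟨h1, h2⟩
        by_contra hne
        exact hno i h1 hne h2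
      · rintro rfl
        exact ⟨hG, Finset.erase_subset _ _⟩
    rw [hset, Finset.sum_singleton, hone G hG] at h
    exact one_ne_zero h

/-- `l` is a maximal chain of the interval from `x` to `y`. -/
def IsMC {X : Type*} [PartialOrder X] (x y : X) (l : List X) : Prop :=
  l.head? = some x ∧ l.getLast? = some y ∧ l.IsChain (· ⋖ ·)

section lists

variable {X : Type*} [PartialOrder X] {Λ : Type*} [LinearOrder Λ]

lemma lab_cons (E : X → X → Λ) (a b : X) (l : List X) :
    chainLabels E (a :: b :: l) = E a b :: chainLabels E (b :: l) := by
  simp [chainLabels]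

lemma lab_split (E : X → X → Λ) (p : List X) (w : X) (q : List X) :
    chainLabels E (p ++ w :: q) = chainLabels E (p ++ [w]) ++ chainLabels E (w :: q) := by
  induction p with
  | nil => simp [chainLabels]
  | cons a p ih =>
    cases p with
    | nil => simp [chainLabels]
    | cons b p =>
      simp only [List.cons_append, lab_cons] at ih ⊢
      rw [ih]

lemma lab_length (E : X → X → Λ) (l : List X) : (chainLabels E l).length = l.length - 1 := by
  simp [chainLabels]

lemma IsMC.split {x y w : X} {p q : List X} :
    IsMC x y (p ++ w :: q) ↔ IsMC x w (p ++ [w]) ∧ IsMC w y (w :: q) := by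
  unfold IsMC
  rw [List.isChain_split]
  have h1 : (p ++ w :: q).head? = (p ++ [w]).head? := by cases p <;> simp
  have h2 : (p ++ w :: q).getLast? = (w :: q).getLast? := by
    rw [List.getLast?_append, List.getLast?_cons]; rfl
  have h3 : (p ++ [w]).getLast? = some w := by simp
  rw [h1, h2, h3]
  simp
  tauto

lemma IsMC.cons_inv {x y : X} {l : List X} (h : IsMC x y l) :
    (l = [x] ∧ x = y) ∨ ∃ z q, l = x :: z :: q ∧ x ⋖ z ∧ IsMC z y (z :: q) := by
  obtain ⟨h1, h2, h3⟩ := h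
  match l with
  | [] => simp at h1
  | [a] => left; simp at h1 h2; subst h1; simp [h2]
  | a :: z :: q =>
    right
    simp at h1; subst h1
    rw [List.isChain_cons_cons] at h3
    exact ⟨z, q, rfl, h3.1, rfl, by simpa [List.getLast?_cons_cons] using h2, h3.2⟩

lemma IsMC.single (x : X) : IsMC x x [x] := ⟨rfl, rfl, List.isChain_singleton _⟩

lemma IsMC.cons {x y z : X} {q : List X} (h : x ⋖ z) (hq : IsMC z y (z :: q)) :
    IsMC x y (x :: z :: q) :=
  ⟨rfl, by simpa [List.getLast?_cons_cons] using hq.2.1, List.isChain_cons_cons.2 ⟨h, hq.2.2⟩⟩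

lemma IsMC.pairwise {x y : X} {l : List X} (h : IsMC x y l) : l.Pairwise (· < ·) :=
  List.isChain_iff_pairwise.1 (h.2.2.imp fun _ _ h => h.lt)

lemma IsMC.eq_cons {x y : X} {l : List X} (h : IsMC x y l) : ∃ q, l = x :: q := by
  rcases h.cons_inv with h | ⟨z, q, h, _⟩
  · exact ⟨_, h.1⟩
  · exact ⟨_, h⟩

lemma IsMC.eq_snoc {x y : X} {l : List X} (h : IsMC x y l) : ∃ q, l = q ++ [y] := by
  have := h.2.1
  rw [List.getLast?_eq_some_iff] at this
  exact this

lemma IsMC.ge {x y : X} {l : List X} (h : IsMC x y l) {v : X} (hv : v ∈ l) : x ≤ v := by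
  obtain ⟨q, rfl⟩ := h.eq_cons
  have := h.pairwise
  rw [List.pairwise_cons] at this
  rcases List.mem_cons.1 hv with rfl | hv
  · exact le_rfl
  · exact (this.1 v hv).le

lemma IsMC.le {x y : X} {l : List X} (h : IsMC x y l) {v : X} (hv : v ∈ l) : v ≤ y := by
  obtain ⟨q, rfl⟩ := h.eq_snoc
  have := h.pairwise
  rw [List.pairwise_append] at this
  rcases List.mem_append.1 hv with hv | hv
  · exact (this.2.2 v hv y (by simp)).le
  · simp at hv; exact hv.le

lemma IsMC.left_mem {x y : X} {l : List X} (h : IsMC x y l) : x ∈ l := by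
  obtain ⟨q, rfl⟩ := h.eq_cons; simp

lemma IsMC.right_mem {x y : X} {l : List X} (h : IsMC x y l) : y ∈ l := by
  obtain ⟨q, rfl⟩ := h.eq_snoc; simp

lemma IsMC.le' {x y : X} {l : List X} (h : IsMC x y l) : x ≤ y := h.le h.left_mem

lemma IsMC.length {rk : X → ℕ} (hgrade : ∀ a b : X, a ⋖ b → rk b = rk a + 1) :
    ∀ {l : List X} {x y : X}, IsMC x y l → rk y + 1 = rk x + l.length := by
  intro l
  induction l with
  | nil => intro x y h; simp [IsMC] at h
  | cons a l ih =>
    intro x y h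
    rcases h.cons_inv with ⟨h1, rfl⟩ | ⟨z, q, h1, h2, h3⟩
    · rw [h1]; simp
    · have h4 : l = z :: q := (List.cons.inj h1).2
      rw [← h4] at h3
      have := ih h3
      have := hgrade _ _ h2
      simp; omega

lemma IsMC.rk_lt {rk : X → ℕ} (hgrade : ∀ a b : X, a ⋖ b → rk b = rk a + 1)
    {x y : X} {l : List X} (h : IsMC x y l) (hne : x ≠ y) : rk x < rk y := by
  have := h.length hgrade
  rcases h.cons_inv with h' | ⟨z, q, rfl, _⟩
  · exact absurd h'.2 hne
  · simp at this; omega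

lemma IsMC.comparable {x y : X} {l : List X} (h : IsMC x y l) {u v : X} (hu : u ∈ l) (hv : v ∈ l) :
    u < v ∨ u = v ∨ v < u := by
  have := h.pairwise
  obtain ⟨p, q, rfl⟩ := List.append_of_mem hu
  rw [List.pairwise_append, List.pairwise_cons] at this
  rcases List.mem_append.1 hv with hv | hv
  · exact Or.inr (Or.inr (this.2.2 v hv u (by simp)))
  · rcases List.mem_cons.1 hv with rfl | hv
    · exact Or.inr (Or.inl rfl)
    · exact Or.inl (this.2.1.1 v hv)

lemma IsMC.ext {x y x' y' : X} {l l' : List X} (h : IsMC x y l) (h' : IsMC x' y' l')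
    (hm : ∀ v, v ∈ l ↔ v ∈ l') : l = l' := by
  have n1 : l.Nodup := h.pairwise.imp fun h => h.ne
  have n2 : l'.Nodup := h'.pairwise.imp fun h => h.ne
  exact List.Perm.eq_of_pairwise (fun a b _ _ h1 h2 => absurd h2 h1.asymm) h.pairwise h'.pairwise
    ((List.perm_ext_iff_of_nodup n1 n2).2 hm)

lemma lex_append {l₁ l₂ : List Λ} (h : l₁ < l₂) (hl : l₁.length = l₂.length) (p q₁ q₂ : List Λ) :
    p ++ (l₁ ++ q₁) < p ++ (l₂ ++ q₂) := by
  refine List.Lex.append_left _ ?_ p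
  change List.Lex (· < ·) l₁ l₂ at h
  induction h with
  | nil => simp at hl
  | rel h => exact List.Lex.rel h
  | cons h ih => exact List.Lex.cons (ih (by simpa using hl))

lemma lab_lt_of_seg {E : X → X → Λ} {p s t q : List X} {a b : X} (hl : s.length = t.length)
    (h : chainLabels E (a :: s ++ [b]) < chainLabels E (a :: t ++ [b])) :
    chainLabels E (p ++ a :: s ++ b :: q) < chainLabels E (p ++ a :: t ++ b :: q) := by
  have key : ∀ s, chainLabels E (p ++ a :: s ++ b :: q) =
      chainLabels E (p ++ [a]) ++ (chainLabels E (a :: s ++ [b]) ++ chainLabels E (b :: q)) := by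
    intro s
    rw [← lab_split, List.append_assoc, List.cons_append, lab_split]
  rw [key, key]
  refine lex_append h ?_ _ _ _
  simp [lab_length, hl]

lemma lab_lt_cons {E : X → X → Λ} {x z : X} {p q : List X}
    (h : chainLabels E (z :: p) < chainLabels E (z :: q)) :
    chainLabels E (x :: z :: p) < chainLabels E (x :: z :: q) := by
  rw [lab_cons, lab_cons]
  exact List.Lex.cons h

lemma isChain_lab_iff {E : X → X → Λ} {R : Λ → Λ → Prop} {l : List X} :
    (chainLabels E l).IsChain R ↔
      ∀ p a v b q, l = p ++ a :: v :: b :: q → R (E a v) (E v b) := by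
  constructor
  · rintro h p a v b q rfl
    rw [lab_split, lab_cons, lab_cons] at h
    have := (List.isChain_append.1 h).2.1
    exact (List.isChain_cons_cons.1 this).1
  · induction l with
    | nil => intro _; simp [chainLabels]
    | cons a l ih =>
      intro h
      match l with
      | [] => simp [chainLabels]
      | [b] => simp [chainLabels]
      | b :: c :: l =>
        rw [lab_cons, lab_cons, List.isChain_cons_cons, ← lab_cons]
        refine ⟨h [] a b c l rfl, ih fun p a' v b' q hl => h (a :: p) a' v b' q (by rw [hl]; rfl)⟩

/-- neighbours of an interior element -/
lemma IsMC.neigh {x y v : X} {l : List X} (h : IsMC x y l) (hv : v ∈ l) (hx : x < v) (hy : v < y) :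
    ∃ p a b q, l = p ++ a :: v :: b :: q := by
  obtain ⟨p, q, rfl⟩ := List.append_of_mem hv
  obtain ⟨h1, h2⟩ := IsMC.split.1 h
  rcases h2.cons_inv with ⟨_, rfl⟩ | ⟨b, q', hq, _⟩
  · exact absurd hy (lt_irrefl _)
  · rcases List.eq_nil_or_concat p with rfl | ⟨p', a, rfl⟩
    · obtain ⟨q2, h3⟩ := h.eq_cons
      simp at h3
      exact absurd hx (by rw [h3.1]; exact lt_irrefl _)
    · refine ⟨p', a, b, q', ?_⟩
      rw [List.cons.inj hq |>.2]; simp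

lemma IsMC.mid {x y a v b : X} {p q : List X} :
    IsMC x y (p ++ a :: v :: b :: q) ↔
      IsMC x a (p ++ [a]) ∧ a ⋖ v ∧ v ⋖ b ∧ IsMC b y (b :: q) := by
  rw [IsMC.split]
  constructor
  · rintro ⟨h1, h2⟩
    rcases h2.cons_inv with ⟨h, _⟩ | ⟨_, _, h, h3, h4⟩
    · simp at h
    · simp at h; obtain ⟨rfl, rfl⟩ := h
      rcases h4.cons_inv with ⟨h, _⟩ | ⟨_, _, h, h5, h6⟩
      · simp at h
      · simp at h; obtain ⟨rfl, rfl⟩ := h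
        exact ⟨h1, h3, h5, h6⟩
  · rintro ⟨h1, h2, h3, h4⟩
    exact ⟨h1, IsMC.cons h2 (IsMC.cons h3 h4)⟩

lemma IsMC.triple {a b v : X} (h1 : a ⋖ v) (h2 : v ⋖ b) : IsMC a b [a, v, b] :=
  IsMC.cons h1 (IsMC.cons h2 (IsMC.single b))

end lists

section shelling

variable {X : Type*} [PartialOrder X] {Λ : Type*} [LinearOrder Λ]

/-- The EL-labelling hypothesis. -/
def ELab (E : X → X → Λ) : Prop :=
  ∀ x y : X, x ≤ y → ∃ l : List X, IsMC x y l ∧ (chainLabels E l).IsChain (· < ·) ∧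
    (∀ l', IsMC x y l' → (chainLabels E l').IsChain (· < ·) → l' = l) ∧
    (∀ l', IsMC x y l' → l' ≠ l → chainLabels E l < chainLabels E l')

lemma IsMC.eq_of_subset {rk : X → ℕ} (hgrade : ∀ a b : X, a ⋖ b → rk b = rk a + 1)
    {x y : X} {l l' : List X} (h : IsMC x y l) (h' : IsMC x y l') (hs : l ⊆ l') : l = l' := by
  have n1 : l.Nodup := h.pairwise.imp fun h => h.ne
  have e1 := h.length hgrade
  have e2 := h'.length hgrade
  have hp := (n1.subperm hs).perm_of_length_le (by omega)
  exact h.ext h' fun v => hp.mem_iff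

lemma IsMC.len3 {rk : X → ℕ} (hgrade : ∀ a b : X, a ⋖ b → rk b = rk a + 1)
    {a b : X} {l : List X} (h : IsMC a b l) (hr : rk b = rk a + 2) :
    ∃ c, l = [a, c, b] ∧ a ⋖ c ∧ c ⋖ b := by
  have e1 := h.length hgrade
  rcases h.cons_inv with ⟨_, rfl⟩ | ⟨c, q, rfl, h1, h2⟩
  · omega
  rcases h2.cons_inv with ⟨h3, rfl⟩ | ⟨d, q', h3, h4, h5⟩
  · have := hgrade _ _ h1; omega
  simp at h3; subst h3
  have : q' = [] := by
    rw [← List.length_eq_zero_iff]; simp at e1; omega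
  subst this
  have := h5.2.1
  simp at this
  subst this
  exact ⟨c, rfl, h1, h4⟩

lemma exists_first {α : Type*} (P : α → Prop) : ∀ (L : List α), (∃ w ∈ L, P w) →
    ∃ s w q, L = s ++ w :: q ∧ P w ∧ ∀ u ∈ s, ¬ P u := by
  intro L
  induction L with
  | nil => simp
  | cons a L ih =>
    intro h
    by_cases ha : P a
    · exact ⟨[], a, L, rfl, ha, by simp⟩
    · obtain ⟨w, hw, hP⟩ := h
      rcases List.mem_cons.1 hw with rfl | hw
      · exact absurd hP ha
      · obtain ⟨s, w', q, rfl, h1, h2⟩ := ih ⟨w, hw, hP⟩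
        refine ⟨a :: s, w', q, rfl, h1, fun u hu => ?_⟩
        rcases List.mem_cons.1 hu with rfl | hu
        · exact ha
        · exact h2 u hu

lemma diverge {E : X → X → Λ} (hE : ELab E) {rk : X → ℕ}
    (hgrade : ∀ a b : X, a ⋖ b → rk b = rk a + 1) :
    ∀ (F : List X) (x y : X) (H : List X), IsMC x y F → IsMC x y H → H ≠ F →
      chainLabels E H ≤ chainLabels E F →
      ∃ p a v b q, F = p ++ a :: v :: b :: q ∧ v ∉ H ∧ ¬ E a v < E v b := by
  intro F
  induction F with
  | nil => intro x y H h; simp [IsMC] at h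
  | cons x0 F ih =>
    intro x y H hF hH hne hle
    obtain ⟨_, hx0⟩ := hF.eq_cons
    obtain ⟨rfl, rfl⟩ := List.cons.inj hx0
    obtain ⟨H, rfl⟩ := hH.eq_cons
    have hFlt : ∀ u ∈ F, x0 < u := (List.pairwise_cons.1 hF.pairwise).1
    have hHlt : ∀ u ∈ H, x0 < u := (List.pairwise_cons.1 hH.pairwise).1
    by_cases hxy : x0 = y
    · subst hxy
      have e1 := hF.length hgrade
      have e2 := hH.length hgrade
      simp at e1 e2
      subst e1 e2
      exact absurd rfl hne
    have hyF : y ∈ F := by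
      rcases List.mem_cons.1 hF.right_mem with h | h
      · exact absurd h.symm hxy
      · exact h
    have hyH : y ∈ H := by
      rcases List.mem_cons.1 hH.right_mem with h | h
      · exact absurd h.symm hxy
      · exact h
    obtain ⟨s, w, q, rfl, hwH, hs⟩ := exists_first (· ∈ H) F ⟨y, hyF, hyH⟩
    obtain ⟨t, r, rfl⟩ := List.append_of_mem hwH
    have hF' : IsMC x0 y ((x0 :: s) ++ w :: q) := hF
    have hH' : IsMC x0 y ((x0 :: t) ++ w :: r) := hH
    obtain ⟨hF1, hF2⟩ := IsMC.split.1 hF'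
    obtain ⟨hH1, hH2⟩ := IsMC.split.1 hH'
    have hlen : s.length = t.length := by
      have e1 := hF1.length hgrade
      have e2 := hH1.length hgrade
      simp at e1 e2
      omega
    cases s with
    | nil =>
      have : t = [] := by rw [← List.length_eq_zero_iff]; simpa using hlen.symm
      subst this
      simp only [List.nil_append] at *
      have hle' : chainLabels E (w :: r) ≤ chainLabels E (w :: q) := by
        by_contra hlt
        exact absurd (lab_lt_cons (x := x0) (not_le.1 hlt)) (not_lt.2 hle)
      obtain ⟨p, a, v, b, q', h1, h2, h3⟩ := ih w y (w :: r) hF2 hH2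
        (fun h => hne (by rw [h])) hle'
      refine ⟨x0 :: p, a, v, b, q', by rw [h1]; rfl, ?_, h3⟩
      rintro h
      rcases List.mem_cons.1 h with rfl | h
      · exact lt_irrefl _ (hFlt v (by rw [h1]; simp))
      · exact h2 h
    | cons z s =>
      have hseg : (x0 :: t) ++ [w] ≠ (x0 :: z :: s) ++ [w] := by
        intro h
        have : t = z :: s := by
          have := List.append_cancel_right h
          exact (List.cons.inj this).2
        exact hs z (by simp) (by rw [this]; simp)
      obtain ⟨l, hl1, hl2, hl3, hl4⟩ := hE x0 w hF1.le'
      have hnr : ¬ (chainLabels E ((x0 :: z :: s) ++ [w])).IsChain (· < ·) := by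
        intro hr
        have := hl3 _ hF1 hr
        subst this
        have h5 := hl4 _ hH1 hseg
        have h6 := lab_lt_of_seg (p := []) (q := q) (E := E) hlen h5
        have h7 : chainLabels E ((x0 :: z :: s) ++ w :: q) <
            chainLabels E ((x0 :: t) ++ w :: r) := by
          rw [lab_split E (x0 :: z :: s), lab_split E (x0 :: t)]
          refine lex_append h5 ?_ [] _ _
          simp only [lab_length, List.length_append, List.length_cons] at hlen ⊢
          omega
        exact absurd h7 (not_lt.2 hle)
      rw [isChain_lab_iff] at hnr
      push Not at hnr
      obtain ⟨p, a, v, b, q', h1, h2⟩ := hnr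
      refine ⟨p, a, v, b, q' ++ q, ?_, ?_, not_lt.2 h2⟩
      · have : x0 :: (z :: s ++ w :: q) = ((x0 :: z :: s) ++ [w]) ++ q := by simp
        rw [this, h1]; simp
      · have hm := hF1
        rw [h1, IsMC.mid] at hm
        obtain ⟨m1, m2, m3, m4⟩ := hm
        have hxv : x0 < v := m1.le'.trans_lt m2.lt
        have hvw : v < w := m3.lt.trans_le m4.le'
        have hv : v ∈ (x0 :: z :: s) ++ [w] := by rw [h1]; simp
        have hv' : v ∈ z :: s := by
          rcases List.mem_append.1 hv with h | h
          · rcases List.mem_cons.1 h with rfl | h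
            · exact absurd hxv (lt_irrefl _)
            · exact h
          · simp at h; subst h; exact absurd hvw (lt_irrefl _)
        intro h
        rcases List.mem_cons.1 h with rfl | h
        · exact absurd hxv (lt_irrefl _)
        · exact hs v hv' h

lemma flip_down {E : X → X → Λ} (hE : ELab E) {rk : X → ℕ}
    (hgrade : ∀ a b : X, a ⋖ b → rk b = rk a + 1) {x y a v b : X} {p q : List X}
    (h : IsMC x y (p ++ a :: v :: b :: q)) (hn : ¬ E a v < E v b) :
    ∃ c, IsMC x y (p ++ a :: c :: b :: q) ∧
      chainLabels E (p ++ a :: c :: b :: q) < chainLabels E (p ++ a :: v :: b :: q) := by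
  obtain ⟨h1, h2, h3, h4⟩ := IsMC.mid.1 h
  obtain ⟨l, l1, l2, l3, l4⟩ := hE a b (h2.lt.trans h3.lt).le
  obtain ⟨c, rfl, c1, c2⟩ := l1.len3 hgrade (by rw [hgrade _ _ h3, hgrade _ _ h2])
  refine ⟨c, IsMC.mid.2 ⟨h1, c1, c2, h4⟩, ?_⟩
  have hne : [a, v, b] ≠ [a, c, b] := by
    intro h
    simp at h; subst h
    simp [chainLabels] at l2
    exact hn l2
  have := lab_lt_of_seg (E := E) (p := p) (q := q) (s := [c]) (t := [v]) rfl
    (l4 _ (IsMC.triple h2 h3) hne)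
  simpa using this

lemma flip_up {E : X → X → Λ} (hE : ELab E) {x y a v b c : X} {p q : List X}
    (h : IsMC x y (p ++ a :: v :: b :: q)) (hn : E a v < E v b) (hc1 : a ⋖ c) (hc2 : c ⋖ b)
    (hcv : c ≠ v) :
    IsMC x y (p ++ a :: c :: b :: q) ∧
      chainLabels E (p ++ a :: v :: b :: q) < chainLabels E (p ++ a :: c :: b :: q) := by
  obtain ⟨h1, h2, h3, h4⟩ := IsMC.mid.1 h
  obtain ⟨l, l1, l2, l3, l4⟩ := hE a b (h2.lt.trans h3.lt).le
  refine ⟨IsMC.mid.2 ⟨h1, hc1, hc2, h4⟩, ?_⟩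
  have := l3 _ (IsMC.triple h2 h3) (by simpa [chainLabels] using hn)
  subst this
  have := lab_lt_of_seg (E := E) (p := p) (q := q) (s := [v]) (t := [c]) rfl
    (l4 _ (IsMC.triple hc1 hc2) (by simpa using hcv))
  simpa using this

open scoped Classical in
/-- interior vertices of a chain -/
noncomputable def facet [Fintype X] (x y : X) (l : List X) : Finset X :=
  Finset.univ.filter (fun v => v ∈ l ∧ x < v ∧ v < y)

lemma mem_facet [Fintype X] {x y v : X} {l : List X} :
    v ∈ facet x y l ↔ v ∈ l ∧ x < v ∧ v < y := by
  simp [facet]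

open scoped Classical in
lemma facet_card [Fintype X] {rk : X → ℕ} (hgrade : ∀ a b : X, a ⋖ b → rk b = rk a + 1)
    {x y : X} {l : List X} (h : IsMC x y l) (hxy : x < y) :
    (facet x y l).card = rk y - rk x - 1 := by
  have e := h.length hgrade
  have hp := h.pairwise
  obtain ⟨q, rfl⟩ := h.eq_cons
  rcases List.eq_nil_or_concat q with rfl | ⟨m, z, rfl⟩
  · have := h.2.1; simp at this; exact absurd this hxy.ne
  have hz : z = y := by
    have := h.2.1
    rw [List.concat_eq_append, ← List.cons_append] at this
    rw [List.getLast?_append] at this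
    simpa using this
  subst hz
  rw [List.concat_eq_append] at *
  have hf : facet x z (x :: (m ++ [z])) = m.toFinset := by
    ext v
    rw [mem_facet, List.mem_toFinset]
    rw [List.pairwise_cons, List.pairwise_append] at hp
    constructor
    · rintro ⟨h1, h2, h3⟩
      rcases List.mem_cons.1 h1 with rfl | h1
      · exact absurd h2 (lt_irrefl _)
      · rcases List.mem_append.1 h1 with h1 | h1
        · exact h1
        · simp at h1; subst h1; exact absurd h3 (lt_irrefl _)
    · intro hv
      exact ⟨by simp [hv], hp.1 v (by simp [hv]), hp.2.2.2 v hv z (by simp)⟩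
  rw [hf, List.toFinset_card_of_nodup]
  · simp at e; omega
  · have : (x :: (m ++ [z])).Nodup := hp.imp fun h => h.ne
    rw [List.nodup_cons, List.nodup_append] at this
    exact this.2.1

open scoped Classical in
lemma facet_erase_subset [Fintype X] {x y a v b c : X} {p q : List X} :
    (facet x y (p ++ a :: v :: b :: q)).erase v ⊆ facet x y (p ++ a :: c :: b :: q) := by
  intro u
  simp only [Finset.mem_erase, mem_facet, List.mem_append, List.mem_cons]
  tauto

open scoped Classical in
lemma facet_neigh [Fintype X] {rk : X → ℕ} (hgrade : ∀ a b : X, a ⋖ b → rk b = rk a + 1)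
    {x y a v b : X} {p q G : List X}
    (h : IsMC x y (p ++ a :: v :: b :: q)) (hG : IsMC x y G)
    (hs : (facet x y (p ++ a :: v :: b :: q)).erase v ⊆ facet x y G) :
    ∃ c, a ⋖ c ∧ c ⋖ b ∧ G = p ++ a :: c :: b :: q := by
  obtain ⟨h1, h2, h3, h4⟩ := IsMC.mid.1 h
  have hin : ∀ u ∈ p ++ a :: v :: b :: q, u ≠ v → u ∈ G := by
    intro u hu huv
    rcases (h.ge hu).eq_or_lt with rfl | hxu
    · exact hG.left_mem
    rcases (h.le hu).eq_or_lt with rfl | huy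
    · exact hG.right_mem
    exact (mem_facet.1 (hs (Finset.mem_erase.2 ⟨huv, mem_facet.2 ⟨hu, hxu, huy⟩⟩))).1
  have haG : a ∈ G := hin a (by simp) h2.lt.ne
  have hbG : b ∈ G := hin b (by simp) h3.lt.ne'
  have hab : a < b := h2.lt.trans h3.lt
  obtain ⟨p1, r, rfl⟩ := List.append_of_mem haG
  obtain ⟨g1, g2⟩ := IsMC.split.1 hG
  have hbr : b ∈ r := by
    rcases List.mem_append.1 hbG with hb | hb
    · have := g1.le (v := b) (by simp [hb])
      exact absurd this (not_le_of_gt hab)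
    · rcases List.mem_cons.1 hb with rfl | hb
      · exact absurd hab (lt_irrefl _)
      · exact hb
  obtain ⟨m, q1, rfl⟩ := List.append_of_mem hbr
  have g2' : IsMC a y ((a :: m) ++ b :: q1) := g2
  obtain ⟨g3, g4⟩ := IsMC.split.1 g2'
  obtain ⟨c, hc, c1, c2⟩ := g3.len3 hgrade (by rw [hgrade _ _ h3, hgrade _ _ h2])
  have hm : m = [c] := by
    have : m ++ [b] = [c] ++ [b] := by simpa using hc
    exact List.append_cancel_right this
  subst hm
  refine ⟨c, c1, c2, ?_⟩
  symm
  refine IsMC.eq_of_subset hgrade (IsMC.mid.2 ⟨h1, c1, c2, h4⟩) hG ?_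
  intro u hu
  by_cases huc : u = c
  · subst huc; simp
  · have hnd : v ∉ p ∧ v ≠ a ∧ v ≠ b ∧ v ∉ q := by
      have : (p ++ a :: v :: b :: q).Nodup := h.pairwise.imp fun h => h.ne
      simp only [List.nodup_append, List.nodup_cons, List.mem_cons] at this
      grind
    apply hin u
    · simp only [List.mem_append, List.mem_cons] at hu ⊢; tauto
    · rintro rfl
      simp only [List.mem_append, List.mem_cons] at hu; tauto

lemma mc_finite [Fintype X] (x y : X) : {l : List X | IsMC x y l}.Finite := by
  refine (List.finite_length_le X (Fintype.card X)).subset ?_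
  intro l hl
  have : l.Nodup := (IsMC.pairwise hl).imp fun h => h.ne
  exact this.length_le_card

noncomputable def mcs [Fintype X] (x y : X) : Finset (List X) := (mc_finite x y).toFinset

lemma mem_mcs [Fintype X] {x y : X} {l : List X} : l ∈ mcs x y ↔ IsMC x y l := by
  simp [mcs]

/-- falling chains -/
def IsFall (E : X → X → Λ) (l : List X) : Prop := (chainLabels E l).IsChain (fun a b => ¬ a < b)

lemma fall_main [Fintype X] {E : X → X → Λ} (hE : ELab E) {rk : X → ℕ}
    (hgrade : ∀ a b : X, a ⋖ b → rk b = rk a + 1)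
    (hsubthin : ∀ a b : X, a < b → rk b = rk a + 2 → Set.ncard {c : X | a < c ∧ c < b} ≤ 2)
    {x y : X} (hxy : x < y) {F : List X} (hF : IsMC x y F) (hfall : IsFall E F) :
    (∀ G, IsMC x y G → G ≠ F → chainLabels E G < chainLabels E F) ∧
    (∀ a b : X, x ≤ a → b ≤ y → a < b → rk b = rk a + 2 →
          Set.ncard {c : X | a < c ∧ c < b} = 2) := by
  classical
  obtain ⟨F0, hF0, -, -, hmin⟩ := hE x y hxy.le
  obtain ⟨r1, r2⟩ := shell_pseudo (mcs x y) (facet x y) (chainLabels E) (rk y - rk x - 1)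
    (fun i hi => facet_card hgrade (mem_mcs.1 hi) hxy)
    (by
      intro F hF H hH hne hle
      obtain ⟨p, a, v, b, q, rfl, hv, hn⟩ :=
        diverge hE hgrade F x y H (mem_mcs.1 hF) (mem_mcs.1 hH) hne hle
      obtain ⟨c, c1, c2⟩ := flip_down hE hgrade (mem_mcs.1 hF) hn
      obtain ⟨m1, m2, m3, m4⟩ := IsMC.mid.1 (mem_mcs.1 hF)
      refine ⟨_, mem_mcs.2 c1, c2, v, ?_, fun h => hv (mem_facet.1 h).1, facet_erase_subset⟩
      exact mem_facet.2 ⟨by simp, m1.le'.trans_lt m2.lt, m3.lt.trans_le m4.le'⟩)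
    F0 (mem_mcs.2 hF0) (fun F hF hne => hmin F (mem_mcs.1 hF) hne)
    (by
      intro F hF v hv
      obtain ⟨v1, v2, v3⟩ := mem_facet.1 hv
      obtain ⟨p, a, b, q, rfl⟩ := (mem_mcs.1 hF).neigh v1 v2 v3
      obtain ⟨m1, m2, m3, m4⟩ := IsMC.mid.1 (mem_mcs.1 hF)
      have h2 := hsubthin a b (m2.lt.trans m3.lt) (by rw [hgrade _ _ m3, hgrade _ _ m2])
      rw [Set.ncard_eq_toFinset_card'] at h2
      refine le_trans (Finset.card_le_card (t := {c : X | a < c ∧ c < b}.toFinset.image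
        (fun c => p ++ a :: c :: b :: q)) ?_) (Finset.card_image_le.trans h2)
      intro G hG
      obtain ⟨g1, g2⟩ := Finset.mem_filter.1 hG
      obtain ⟨c, c1, c2, rfl⟩ := facet_neigh hgrade (mem_mcs.1 hF) (mem_mcs.1 g1) g2
      exact Finset.mem_image.2 ⟨c, by simp [c1.lt, c2.lt], rfl⟩)
    F (mem_mcs.2 hF)
    (by
      intro v hv
      obtain ⟨v1, v2, v3⟩ := mem_facet.1 hv
      obtain ⟨p, a, b, q, rfl⟩ := hF.neigh v1 v2 v3
      obtain ⟨c, c1, c2⟩ := flip_down hE hgrade hF (isChain_lab_iff.1 hfall p a v b q rfl)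
      exact ⟨_, mem_mcs.2 c1, c2, facet_erase_subset⟩)
  refine ⟨fun G hG hne => r1 G (mem_mcs.2 hG) hne, ?_⟩
  intro a b hxa hby hab hr
  refine le_antisymm (hsubthin a b hab hr) ?_
  obtain ⟨l1, hl1, -⟩ := hE x a hxa
  obtain ⟨l2, hl2, -⟩ := hE a b hab.le
  obtain ⟨l3, hl3, -⟩ := hE b y hby
  obtain ⟨v, rfl, v1, v2⟩ := hl2.len3 hgrade hr
  obtain ⟨p, rfl⟩ := hl1.eq_snoc
  obtain ⟨q, rfl⟩ := hl3.eq_cons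
  have hG : IsMC x y (p ++ a :: v :: b :: q) := IsMC.mid.2 ⟨hl1, v1, v2, hl3⟩
  obtain ⟨G', g1, g2, g3⟩ := r2 _ (mem_mcs.2 hG) v
    (mem_facet.2 ⟨by simp, hxa.trans_lt v1.lt, v2.lt.trans_le hby⟩)
  obtain ⟨c, c1, c2, rfl⟩ := facet_neigh hgrade hG (mem_mcs.1 g1) g3
  have hcv : c ≠ v := by rintro rfl; exact g2 rfl
  rw [← Set.ncard_pair hcv]
  refine Set.ncard_le_ncard ?_ (Set.toFinite _)
  intro u hu
  rcases hu with rfl | rfl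
  · exact ⟨c1.lt, c2.lt⟩
  · exact ⟨v1.lt, v2.lt⟩

lemma fall_exists [Fintype X] {E : X → X → Λ} (hE : ELab E) {rk : X → ℕ}
    (hgrade : ∀ a b : X, a ⋖ b → rk b = rk a + 1) {x y : X} (hxy : x < y)
    (hthin : ∀ a b : X, x ≤ a → b ≤ y → a < b → rk b = rk a + 2 →
          Set.ncard {c : X | a < c ∧ c < b} = 2) : ∃ F, IsMC x y F ∧ IsFall E F := by
  obtain ⟨F0, hF0, -⟩ := hE x y hxy.le
  obtain ⟨F, hF, hmax⟩ := Finset.exists_max_image (mcs x y) (chainLabels E) ⟨F0, mem_mcs.2 hF0⟩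
  refine ⟨F, mem_mcs.1 hF, isChain_lab_iff.2 ?_⟩
  rintro p a v b q rfl hlt
  obtain ⟨m1, m2, m3, m4⟩ := IsMC.mid.1 (mem_mcs.1 hF)
  have hr : rk b = rk a + 2 := by rw [hgrade _ _ m3, hgrade _ _ m2]
  have h2 := hthin a b m1.le' m4.le' (m2.lt.trans m3.lt) hr
  obtain ⟨c, hc, hcv⟩ := Set.exists_ne_of_one_lt_ncard (s := {c : X | a < c ∧ c < b})
    (by omega) v
  obtain ⟨l1, hl1, -⟩ := hE a c hc.1.le
  obtain ⟨l2, hl2, -⟩ := hE c b hc.2.le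
  have e1 := hl1.rk_lt hgrade hc.1.ne
  have e2 := hl2.rk_lt hgrade hc.2.ne
  have hcov : a ⋖ c := by
    refine ⟨hc.1, fun d hd1 hd2 => ?_⟩
    obtain ⟨l3, hl3, -⟩ := hE a d hd1.le
    obtain ⟨l4, hl4, -⟩ := hE d c hd2.le
    have := hl3.rk_lt hgrade hd1.ne
    have := hl4.rk_lt hgrade hd2.ne
    omega
  have hcov' : c ⋖ b := by
    refine ⟨hc.2, fun d hd1 hd2 => ?_⟩
    obtain ⟨l3, hl3, -⟩ := hE c d hd1.le
    obtain ⟨l4, hl4, -⟩ := hE d b hd2.le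
    have := hl3.rk_lt hgrade hd1.ne
    have := hl4.rk_lt hgrade hd2.ne
    omega
  obtain ⟨k1, k2⟩ := flip_up hE (mem_mcs.1 hF) hlt hcov hcov' hcv
  exact absurd (hmax _ (mem_mcs.2 k1)) (not_le.2 k2)

end shelling

section moebius

variable {X : Type*} [PartialOrder X] {Λ : Type*} [LinearOrder Λ]

open scoped Classical in
lemma altsum (L : List Λ) (h : L ≠ []) :
    ∑ k ∈ Finset.range (L.length + 1),
      (if (L.take k).IsChain (fun a b => ¬ a < b) ∧ (L.drop k).IsChain (· < ·)
        then (-1 : ℤ) ^ k else 0) = 0 := by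
  induction L with
  | nil => exact absurd rfl h
  | cons a L ih =>
    cases L with
    | nil => simp [Finset.sum_range_succ]
    | cons b L =>
      have ih := ih (by simp)
      rw [List.length_cons, Finset.sum_range_succ']
      by_cases hab : a < b
      · rw [List.length_cons, Finset.sum_range_succ', Finset.sum_eq_zero]
        · simp [List.isChain_cons_cons, hab]
          split_ifs <;> simp
        · intro k _
          simp [List.isChain_cons_cons, hab]
      · have h1 : ∀ k, ((a :: b :: L).take (k + 1)).IsChain (fun a b => ¬ a < b) ↔
            ((b :: L).take k).IsChain (fun a b => ¬ a < b) := by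
          intro k
          cases k with
          | zero => simp
          | succ k => simp only [List.take_succ_cons, List.isChain_cons_cons, hab]; simp
        have h2 : ∀ k, (if ((a :: b :: L).take (k + 1)).IsChain (fun a b => ¬ a < b) ∧
            ((a :: b :: L).drop (k + 1)).IsChain (· < ·) then (-1 : ℤ) ^ (k + 1) else 0) =
            - (if ((b :: L).take k).IsChain (fun a b => ¬ a < b) ∧
            ((b :: L).drop k).IsChain (· < ·) then (-1 : ℤ) ^ k else 0) := by
          intro k
          simp only [h1, List.drop_succ_cons]
          split_ifs <;> ring
        rw [Finset.sum_congr rfl (fun k _ => h2 k), Finset.sum_neg_distrib, ih]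
        simp [List.isChain_cons_cons, hab]

open scoped Classical in
noncomputable def falls [Fintype X] (E : X → X → Λ) (x y : X) : Finset (List X) :=
  (mcs x y).filter (IsFall E)

lemma mem_falls [Fintype X] {E : X → X → Λ} {x y : X} {l : List X} :
    l ∈ falls E x y ↔ IsMC x y l ∧ IsFall E l := by
  simp [falls, mem_mcs]

lemma valid_iff {E : X → X → Λ} {p q : List X} {w : X} {k : ℕ} (hk : k = p.length) :
    (((chainLabels E (p ++ w :: q)).take k).IsChain (fun a b => ¬ a < b) ∧
      ((chainLabels E (p ++ w :: q)).drop k).IsChain (· < ·)) ↔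
    IsFall E (p ++ [w]) ∧ (chainLabels E (w :: q)).IsChain (· < ·) := by
  have hl : (chainLabels E (p ++ [w])).length = k := by rw [lab_length]; simp [hk]
  rw [lab_split, List.take_left' hl, List.drop_left' hl]
  rfl

open scoped Classical in
lemma falls_sum [Fintype X] {E : X → X → Λ} (hE : ELab E) {rk : X → ℕ}
    (hgrade : ∀ a b : X, a ⋖ b → rk b = rk a + 1) {x y : X} (hxy : x < y) :
    ∑ z ∈ Finset.univ.filter (fun z => x ≤ z ∧ z ≤ y),
      (-1 : ℤ) ^ (rk z - rk x) * ((falls E x z).card : ℤ) = 0 := by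
  have hr : ∀ z, ∃ t, z ≤ y → IsMC z y (z :: t) ∧ (chainLabels E (z :: t)).IsChain (· < ·) ∧
      ∀ l', IsMC z y l' → (chainLabels E l').IsChain (· < ·) → l' = z :: t := by
    intro z
    by_cases hz : z ≤ y
    · obtain ⟨l, h1, h2, h3, -⟩ := hE z y hz
      obtain ⟨t, rfl⟩ := h1.eq_cons
      exact ⟨t, fun _ => ⟨h1, h2, h3⟩⟩
    · exact ⟨[], fun h => absurd h hz⟩
  choose t ht using hr
  set n := rk y - rk x with hn
  have hP : ∑ c ∈ mcs x y, ∑ k ∈ Finset.range (n + 1),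
      (if ((chainLabels E c).take k).IsChain (fun a b => ¬ a < b) ∧
        ((chainLabels E c).drop k).IsChain (· < ·) then (-1 : ℤ) ^ k else 0) = 0 := by
    refine Finset.sum_eq_zero fun c hc => ?_
    have e := (mem_mcs.1 hc).length hgrade
    have e2 := (mem_mcs.1 hc).rk_lt hgrade hxy.ne
    have hl : (chainLabels E c).length = n := by rw [lab_length]; omega
    have := altsum (chainLabels E c) (by
      intro h; rw [h] at hl; simp at hl; omega)
    rw [hl] at this
    exact this
  rw [← Finset.sum_product', ← Finset.sum_filter] at hP
  rw [← hP]
  have hL : ∀ z, (-1 : ℤ) ^ (rk z - rk x) * ((falls E x z).card : ℤ) =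
      ∑ l ∈ falls E x z, (-1 : ℤ) ^ (rk z - rk x) := by
    intro z; rw [Finset.sum_const, nsmul_eq_mul, mul_comm]
  rw [Finset.sum_congr rfl (fun z _ => hL z), Finset.sum_sigma']
  refine Finset.sum_bij (fun s _ => (s.2 ++ t s.1, rk s.1 - rk x)) ?_ ?_ ?_ ?_
  · rintro ⟨z, l⟩ h
    simp only [Finset.mem_sigma, Finset.mem_filter, Finset.mem_univ, true_and, mem_falls] at h
    obtain ⟨⟨h1, h2⟩, h3, h4⟩ := h
    obtain ⟨p, rfl⟩ := h3.eq_snoc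
    obtain ⟨t1, t2, -⟩ := ht z h2
    have e := h3.length hgrade
    have e' := t1.length hgrade
    simp at e e'
    simp only [Finset.mem_filter, Finset.mem_product, Finset.mem_range, mem_mcs, List.append_assoc,
      List.singleton_append]
    refine ⟨⟨IsMC.split.2 ⟨h3, t1⟩, by omega⟩, ?_⟩
    exact (valid_iff (by omega)).2 ⟨h4, t2⟩
  · rintro ⟨z, l⟩ h ⟨z', l'⟩ h' heq
    simp only [Finset.mem_sigma, Finset.mem_filter, Finset.mem_univ, true_and, mem_falls] at h h'
    obtain ⟨⟨h1, h2⟩, h3, h4⟩ := h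
    obtain ⟨⟨h1', h2'⟩, h3', h4'⟩ := h'
    simp only [Prod.mk.injEq] at heq
    have e := h3.length hgrade
    have e' := h3'.length hgrade
    have k1 : 0 < l.length := by obtain ⟨_, rfl⟩ := h3.eq_cons; simp
    have k2 : 0 < l'.length := by obtain ⟨_, rfl⟩ := h3'.eq_cons; simp
    have hll := (List.append_inj heq.1 (by omega)).1
    subst hll
    have : z = z' := Option.some.inj (h3.2.1.symm.trans h3'.2.1)
    subst this
    rfl
  · rintro ⟨c, k⟩ h
    simp only [Finset.mem_filter, Finset.mem_product, Finset.mem_range, mem_mcs] at h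
    obtain ⟨⟨h1, h2⟩, h3⟩ := h
    have e := h1.length hgrade
    have e2 := h1.rk_lt hgrade hxy.ne
    have hk : k < c.length := by omega
    obtain ⟨p, w, q, rfl, hp⟩ : ∃ (p : List X) (w : X) (q : List X),
        c = p ++ w :: q ∧ k = p.length :=
      ⟨c.take k, c.get ⟨k, hk⟩, c.drop (k + 1), by simp, by simp; omega⟩
    obtain ⟨v1, v2⟩ := (valid_iff hp).1 h3
    obtain ⟨m1, m2⟩ := IsMC.split.1 h1
    have hw := (ht w m2.le').2.2 _ m2 v2
    have e3 := m1.length hgrade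
    simp at e3
    refine ⟨⟨w, p ++ [w]⟩, ?_, ?_⟩
    · simp only [Finset.mem_sigma, Finset.mem_filter, Finset.mem_univ, true_and, mem_falls]
      exact ⟨⟨m1.le', m2.le'⟩, m1, v1⟩
    · simp only [List.append_assoc, List.singleton_append, ← hw, Prod.mk.injEq, true_and]
      omega
  · intros; rfl

open scoped Classical in
lemma moebius_eq [Fintype X] {E : X → X → Λ} (hE : ELab E) {rk : X → ℕ}
    (hgrade : ∀ a b : X, a ⋖ b → rk b = rk a + 1)
    (μ : X → X → ℤ) (hμrefl : ∀ x : X, μ x x = 1)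
    (hμrec : ∀ x y : X, x < y →
      μ x y = -∑ z ∈ Finset.univ.filter (fun z => x ≤ z ∧ z < y), μ x z) (x : X) :
    ∀ (n : ℕ) (y : X), rk y = n → x ≤ y →
      μ x y = (-1 : ℤ) ^ (rk y - rk x) * ((falls E x y).card : ℤ) := by
  intro n
  induction n using Nat.strong_induction_on with
  | _ n ih =>
    intro y hy hxy
    rcases hxy.eq_or_lt with rfl | hlt
    · have : falls E x x = {[x]} := by
        ext l
        rw [mem_falls, Finset.mem_singleton]
        constructor
        · rintro ⟨h, -⟩
          have e := h.length hgrade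
          obtain ⟨q, rfl⟩ := h.eq_cons
          simp at e
          rw [e]
        · rintro rfl
          exact ⟨IsMC.single x, by simp [IsFall, chainLabels]⟩
      rw [this, hμrefl]; simp
    · rw [hμrec x y hlt]
      have hs := falls_sum hE hgrade hlt
      have hset : Finset.univ.filter (fun z => x ≤ z ∧ z ≤ y) =
          insert y (Finset.univ.filter (fun z => x ≤ z ∧ z < y)) := by
        ext z
        simp only [Finset.mem_filter, Finset.mem_univ, true_and, Finset.mem_insert, le_iff_lt_or_eq]
        constructor
        · rintro ⟨h1, h2 | h2⟩
          · exact Or.inr ⟨h1, h2⟩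
          · exact Or.inl h2
        · rintro (rfl | ⟨h1, h2⟩)
          · exact ⟨Or.inl hlt, Or.inr rfl⟩
          · exact ⟨h1, Or.inl h2⟩
      rw [hset, Finset.sum_insert (by simp)] at hs
      rw [Finset.sum_congr rfl (g := fun z => (-1 : ℤ) ^ (rk z - rk x) * ((falls E x z).card : ℤ))]
      · linarith
      · intro z hz
        simp only [Finset.mem_filter, Finset.mem_univ, true_and] at hz
        obtain ⟨l, hl, -⟩ := hE z y hz.2.le
        have := hl.rk_lt hgrade hz.2.ne
        exact ih (rk z) (by omega) z rfl hz.1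

end moebius

open scoped Classical in
/-- Let `X` be a finite bounded graded subthin poset which is EL-shellable (there is
an edge labelling `E` such that between any two comparable elements there is a unique
maximal chain with strictly increasing labels, and this chain is lexicographically
minimal among all maximal chains).  Let `μ` be the Möbius function of `X`.  Then for
`x < y`: if the interval `[x, y]` is thin (every rank-two open subinterval has
exactly two elements) then `μ x y = (-1) ^ (rk y - rk x)`, and if `[x, y]` is subthin
but not thin then `μ x y = 0`. -/
theorem stmt_15 {X : Type*} [PartialOrder X] [Fintype X] [BoundedOrder X]
    {Λ : Type*} [LinearOrder Λ]
    (rk : X → ℕ) (hbot : rk ⊥ = 0)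
    (hgrade : ∀ a b : X, a ⋖ b → rk b = rk a + 1)
    (hsubthin : ∀ a b : X, a < b → rk b = rk a + 2 →
      Set.ncard {c : X | a < c ∧ c < b} ≤ 2)
    (E : X → X → Λ)
    (hEL : ∀ x y : X, x ≤ y → ∃ l : List X,
      (l.head? = some x ∧ l.getLast? = some y ∧ l.Chain' (· ⋖ ·) ∧
        (chainLabels E l).Chain' (· < ·)) ∧
      (∀ l' : List X, l'.head? = some x → l'.getLast? = some y → l'.Chain' (· ⋖ ·) →
        (chainLabels E l').Chain' (· < ·) → l' = l) ∧
      (∀ l' : List X, l'.head? = some x → l'.getLast? = some y → l'.Chain' (· ⋖ ·) →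
        l' ≠ l → List.Lex (· < ·) (chainLabels E l) (chainLabels E l')))
    (μ : X → X → ℤ) (hμrefl : ∀ x : X, μ x x = 1)
    (hμrec : ∀ x y : X, x < y →
      μ x y = -∑ z ∈ Finset.univ.filter (fun z => x ≤ z ∧ z < y), μ x z)
    (hμnle : ∀ x y : X, ¬ x ≤ y → μ x y = 0) :
    ∀ x y : X, x < y →
      ((∀ a b : X, x ≤ a → b ≤ y → a < b → rk b = rk a + 2 →
          Set.ncard {c : X | a < c ∧ c < b} = 2) →
        μ x y = (-1) ^ (rk y - rk x)) ∧
      ((∃ a b : X, x ≤ a ∧ b ≤ y ∧ a < b ∧ rk b = rk a + 2 ∧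
          Set.ncard {c : X | a < c ∧ c < b} < 2) →
        μ x y = 0) := by
  have hE : ELab E := by
    intro x y hxy
    obtain ⟨l, ⟨h1, h2, h3, h4⟩, h5, h6⟩ := hEL x y hxy
    exact ⟨l, ⟨h1, h2, h3⟩, h4, fun l' h => h5 l' h.1 h.2.1 h.2.2,
      fun l' h => h6 l' h.1 h.2.1 h.2.2⟩
  intro x y hxy
  have hμ := moebius_eq hE hgrade μ hμrefl hμrec x (rk y) y rfl hxy.le
  constructor
  · intro hthin
    obtain ⟨F, hF, hfall⟩ := fall_exists hE hgrade hxy hthin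
    have : falls E x y = {F} := by
      ext G
      rw [mem_falls, Finset.mem_singleton]
      constructor
      · rintro ⟨h1, h2⟩
        by_contra hne
        exact lt_asymm ((fall_main hE hgrade hsubthin hxy hF hfall).1 G h1 hne)
          ((fall_main hE hgrade hsubthin hxy h1 h2).1 F hF (Ne.symm hne))
      · rintro rfl
        exact ⟨hF, hfall⟩
    rw [hμ, this]
    simp
  · rintro ⟨a, b, h1, h2, h3, h4, h5⟩
    have : falls E x y = ∅ := by
      rw [Finset.eq_empty_iff_forall_notMem]
      intro F hF
      obtain ⟨f1, f2⟩ := mem_falls.1 hF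
      have := (fall_main hE hgrade hsubthin hxy f1 f2).2 a b h1 h2 h3 h4
      omega
    rw [hμ, this]
    simp
end
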